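/- arXiv:1103.2312 — 2 statements merged into one kernel-verified Lean document; each statement's English description precedes it below -/
import Mathlib

section
/- If a countable Borel equivalence relation E on a standard Borel space X has property 𝗌 (Borel non-splitting), then E is smooth. -/
open Filter

/-- Eventual equality on `2^ℕ` (i.e. finite symmetric difference, `=*`). -/
def EvEqB (x y : ℕ → Bool) : Prop := ∀ᶠ n in Filter.atTop, x n = y n

/-- `x` is an infinite subset of `ℕ` (i.e. `x ∈ [ℕ]^ℕ`). -/
def IsInfSet (x : ℕ → Bool) : Prop := {n | x n = true}.Infinite

/-- Almost containment `x ⊆* y`: `x \ y` is finite. -/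
def AlmostSubset (x y : ℕ → Bool) : Prop := {n | x n = true ∧ y n = false}.Finite

/-- The complement `ℕ \ x` of a subset of `ℕ`. -/
def complB (x : ℕ → Bool) : ℕ → Bool := fun n => !(x n)

/-- `E` has property `𝗌` (Borel non-splitting): for every Borel homomorphism
`φ : X → ([ℕ]^ℕ)^ℕ` from `E` to `E_set`, there is a Borel homomorphism
`ψ : X → [ℕ]^ℕ` from `E` to `=*` such that for all `x` and `n`, either
`ψ(x) ⊆* φ(x)(n)` or `ψ(x) ⊆* ℕ \ φ(x)(n)`. -/
def PropertyS {X : Type*} [MeasurableSpace X] (E : X → X → Prop) : Prop :=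
  ∀ φ : X → ℕ → ℕ → Bool, Measurable φ → (∀ x n, IsInfSet (φ x n)) →
    (∀ x y, E x y → Set.range (φ x) = Set.range (φ y)) →
    ∃ ψ : X → ℕ → Bool, Measurable ψ ∧ (∀ x, IsInfSet (ψ x)) ∧
      (∀ x y, E x y → EvEqB (ψ x) (ψ y)) ∧
      ∀ x n, AlmostSubset (ψ x) (φ x n) ∨ AlmostSubset (ψ x) (complB (φ x n))

open Set Topology MeasureTheory

section LusinNovikov

variable {Z X : Type*}

/-- `S` is covered by countably many Borel sets on each of which `π` is injective. -/
def IsSigmaInjOn [MeasurableSpace Z] (π : Z → X) (S : Set Z) : Prop :=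
  ∃ B : ℕ → Set Z, (∀ n, MeasurableSet (B n)) ∧ (∀ n, InjOn π (B n)) ∧ S ⊆ ⋃ n, B n

theorem IsSigmaInjOn.iUnion [MeasurableSpace Z] {π : Z → X} {ι : Type*} [Countable ι]
    {S : ι → Set Z} (h : ∀ i, IsSigmaInjOn π (S i)) : IsSigmaInjOn π (⋃ i, S i) := by
  rcases isEmpty_or_nonempty ι with hι | hι
  · exact ⟨fun _ => ∅, by simp, by simp, by simp⟩
  choose B hBm hBi hBS using h
  obtain ⟨e, he⟩ := exists_surjective_nat (ι × ℕ)
  refine ⟨fun n => B (e n).1 (e n).2, fun n => hBm _ _, fun n => hBi _ _, ?_⟩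
  refine iUnion_subset fun i z hz => ?_
  obtain ⟨k, hk⟩ := mem_iUnion.1 (hBS i hz)
  obtain ⟨n, hn⟩ := he (i, k)
  exact mem_iUnion.2 ⟨n, by simpa [hn] using hk⟩

theorem IsSigmaInjOn.of_injOn [MeasurableSpace Z] {π : Z → X} {B : Set Z}
    (hB : MeasurableSet B) (hi : InjOn π B) : IsSigmaInjOn π B :=
  ⟨fun _ => B, fun _ => hB, fun _ => hi, subset_iUnion (fun _ : ℕ => B) 0⟩

theorem IsSigmaInjOn.union [MeasurableSpace Z] {π : Z → X} {S T : Set Z}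
    (hS : IsSigmaInjOn π S) (hT : IsSigmaInjOn π T) : IsSigmaInjOn π (S ∪ T) := by
  rw [union_eq_iUnion]
  exact IsSigmaInjOn.iUnion fun b => by cases b <;> assumption

/-- The points sharing a fibre of `π` with some other point of an analytic set form an analytic
set. -/
theorem analyticSet_fiber_neighbors [TopologicalSpace Z] [PolishSpace Z] [TopologicalSpace X]
    [T2Space X] {π : Z → X} (hπ : Continuous π) {A : Set Z} (hA : AnalyticSet A) :
    AnalyticSet {z | ∃ w ∈ A, π z = π w ∧ z ≠ w} := by
  borelize Z
  have hN : MeasurableSet {p : Z × Z | π p.1 = π p.2 ∧ p.1 ≠ p.2} :=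
    (isClosed_eq (hπ.comp continuous_fst) (hπ.comp continuous_snd)).measurableSet.inter
      (isOpen_ne_fun continuous_fst continuous_snd).measurableSet
  have hI : AnalyticSet ((Prod.snd ⁻¹' A) ∩ {p : Z × Z | π p.1 = π p.2 ∧ p.1 ≠ p.2}) := by
    rw [inter_eq_iInter]
    refine AnalyticSet.iInter fun b => ?_
    cases b
    · exact hN.analyticSet
    · exact hA.preimage continuous_snd
  have h := hI.image_of_continuous continuous_fst
  convert h using 1
  ext z
  simp only [mem_ofPred_eq, mem_image, mem_inter_iff, mem_preimage, Prod.exists]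
  constructor
  · rintro ⟨w, hw, h⟩
    exact ⟨z, w, ⟨hw, h⟩, rfl⟩
  · rintro ⟨_, w, ⟨hw, h⟩, rfl⟩
    exact ⟨w, hw, h⟩

/-- An analytic set on which `π` is injective extends to a Borel set on which `π` is injective. -/
theorem exists_measurableSet_injOn_of_analyticSet [TopologicalSpace Z] [PolishSpace Z]
    [MeasurableSpace Z] [BorelSpace Z] [TopologicalSpace X] [T2Space X] {π : Z → X}
    (hπ : Continuous π) {A : Set Z} (hA : AnalyticSet A) (hi : InjOn π A) :
    ∃ B, MeasurableSet B ∧ A ⊆ B ∧ InjOn π B := by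
  obtain ⟨u, hAu, hdu, hu⟩ := hA.measurablySeparable (analyticSet_fiber_neighbors hπ hA) (by
    rw [disjoint_left]
    rintro z hz ⟨w, hw, h, hne⟩
    exact hne (hi hz hw h))
  obtain ⟨v, hAv, hdv, hv⟩ := hA.measurablySeparable
    (analyticSet_fiber_neighbors hπ hu.analyticSet) (by
    rw [disjoint_left]
    rintro z hz ⟨w, hw, h, hne⟩
    exact disjoint_left.1 hdu ⟨z, hz, h.symm, hne.symm⟩ hw)
  refine ⟨u ∩ v, hu.inter hv, subset_inter hAu hAv, fun z hz w hw h => ?_⟩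
  by_contra hne
  exact disjoint_left.1 hdv ⟨w, hw.1, h, hne⟩ hz.2

/-- However a `π`-small set is removed from `Z`, some fibre of `π` still contains points
`z 0 ∈ a 0, …, z m ∈ a m`. -/
def IsLargeBox [MeasurableSpace Z] (π : Z → X) (m : ℕ) (a : ℕ → Set Z) : Prop :=
  ∀ Y, MeasurableSet Y → IsSigmaInjOn π Yᶜ →
    ∃ z : ℕ → Z, ∀ i ≤ m, z i ∈ Y ∧ z i ∈ a i ∧ π (z i) = π (z 0)

theorem IsLargeBox.exists_split [MetricSpace Z] [CompleteSpace Z] [SecondCountableTopology Z]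
    [MeasurableSpace Z] [BorelSpace Z] [TopologicalSpace X] [T2Space X] {π : Z → X}
    (hπ : Continuous π) {m : ℕ} {a : ℕ → Set Z} (ha : ∀ i, IsOpen (a i))
    (hl : IsLargeBox π m a) {j : ℕ} (hj : j ≤ m) {ε : ℝ} (hε : 0 < ε) :
    ∃ b : ℕ → Set Z, (∀ i, IsOpen (b i)) ∧ IsLargeBox π (m + 1) b ∧
      (∀ i ≤ m, closure (b i) ⊆ a i) ∧ closure (b (m + 1)) ⊆ a j ∧
      Disjoint (b j) (b (m + 1)) ∧
      ∀ i ≤ m + 1, ∀ x ∈ b i, ∀ y ∈ b i, dist x y ≤ ε := by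
  by_contra hcon
  push Not at hcon
  have hB := TopologicalSpace.isBasis_countableBasis Z
  let ext : (Fin (m + 2) → TopologicalSpace.countableBasis Z) → ℕ → Set Z :=
    fun c i => if h : i < m + 2 then (c ⟨i, h⟩ : Set Z) else univ
  have hext : ∀ c i, IsOpen (ext c i) := by
    intro c i
    dsimp only [ext]
    split_ifs with h
    · exact hB.isOpen (c _).2
    · exact isOpen_univ
  let good : (Fin (m + 2) → TopologicalSpace.countableBasis Z) → Prop := fun c =>
    (∀ i ≤ m, closure (ext c i) ⊆ a i) ∧ closure (ext c (m + 1)) ⊆ a j ∧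
      Disjoint (ext c j) (ext c (m + 1)) ∧
      ∀ i ≤ m + 1, ∀ x ∈ ext c i, ∀ y ∈ ext c i, dist x y ≤ ε
  have hbad : ∀ c : {c // good c}, ∃ Y, MeasurableSet Y ∧ IsSigmaInjOn π Yᶜ ∧
      ∀ z : ℕ → Z, ¬ ∀ i ≤ m + 1, z i ∈ Y ∧ z i ∈ ext c i ∧ π (z i) = π (z 0) := by
    rintro ⟨c, h1, h2, h3, h4⟩
    by_contra hno
    push Not at hno
    obtain ⟨i, hi, x, hx, y, hy, hd⟩ := hcon (ext c) (hext c)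
      (fun Y hY hs => by simpa using hno Y hY hs) h1 h2 h3
    exact absurd (h4 i hi x hx y hy) (not_le.2 hd)
  choose Y hYm hYs hYn using hbad
  have hYc : IsSigmaInjOn π (⋂ c, Y c)ᶜ := by
    rw [compl_iInter]
    exact IsSigmaInjOn.iUnion hYs
  have hYcm : MeasurableSet (⋂ c, Y c) := MeasurableSet.iInter hYm
  set W := ⋂ c, Y c with hW
  let H : Set (ℕ → Z) := {z | ∀ i ≤ m, z i ∈ W ∧ z i ∈ a i ∧ π (z i) = π (z 0)}
  have hH : MeasurableSet H := by
    have : H = ⋂ i, ⋂ _ : i ≤ m, ((fun z : ℕ → Z => z i) ⁻¹' (W ∩ a i)) ∩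
        {z | π (z i) = π (z 0)} := by
      ext z
      simp [H, and_assoc]
    rw [this]
    refine MeasurableSet.iInter fun i => MeasurableSet.iInter fun _ => ?_
    refine MeasurableSet.inter ((measurable_pi_apply i) (hYcm.inter (ha i).measurableSet)) ?_
    exact (isClosed_eq (hπ.comp (continuous_apply i)) (hπ.comp (continuous_apply 0))).measurableSet
  have hA : AnalyticSet ((fun z : ℕ → Z => z j) '' H) :=
    hH.analyticSet.image_of_continuous (continuous_apply j)
  have hinj : InjOn π ((fun z : ℕ → Z => z j) '' H) := by
    rintro _ ⟨z, hz, rfl⟩ _ ⟨w, hw, rfl⟩ hzw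
    by_contra hne
    dsimp only at hzw hne
    let p : ℕ → Z := fun i => if i ≤ m then z i else w j
    have hpm : p (m + 1) = w j := by simp [p]
    have hpi : ∀ i ≤ m, p i = z i := fun i hi => by simp [p, hi]
    let q : ℕ → Set Z := fun i => if i ≤ m then a i else a j
    have hq : ∀ i ≤ m + 1, p i ∈ W ∧ p i ∈ q i ∧ π (p i) = π (p 0) := by
      intro i hi
      rw [hpi 0 (Nat.zero_le _)]
      rcases Nat.lt_or_ge m i with h | h
      · obtain rfl : i = m + 1 := by omega
        rw [hpm]
        refine ⟨(hw j hj).1, ?_, ?_⟩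
        · simpa [q] using (hw j hj).2.1
        · rw [← hzw, (hz j hj).2.2]
      · rw [hpi i h]
        refine ⟨(hz i h).1, ?_, (hz i h).2.2⟩
        simpa [q, h] using (hz i h).2.1
    have hqo : ∀ i, IsOpen (q i) := fun i => by
      dsimp only [q]; split_ifs <;> exact ha _
    have hδ : 0 < min (ε / 2) (dist (z j) (w j) / 2) :=
      lt_min (half_pos hε) (half_pos (dist_pos.2 hne))
    set δ := min (ε / 2) (dist (z j) (w j) / 2)
    have hc : ∀ i : Fin (m + 2), ∃ t ∈ TopologicalSpace.countableBasis Z,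
        p i ∈ t ∧ closure t ⊆ q i ∩ Metric.ball (p i) δ := fun i =>
      hB.exists_closure_subset (Filter.inter_mem
        ((hqo i).mem_nhds (hq i (by omega)).2.1) (Metric.ball_mem_nhds _ hδ))
    choose c hcB hpc hcq using hc
    let c' : Fin (m + 2) → TopologicalSpace.countableBasis Z := fun i => ⟨c i, hcB i⟩
    have hc' : ∀ i (h : i ≤ m + 1), ext c' i = c ⟨i, by omega⟩ := fun i h => by
      dsimp only [ext]
      rw [dif_pos (by omega)]
    have hball : ∀ i ≤ m + 1, ∀ x ∈ ext c' i, dist x (p i) < δ := fun i hi x hx => by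
      rw [hc' i hi] at hx
      exact (hcq _ (subset_closure hx)).2
    have hgood : good c' := by
      refine ⟨fun i hi => ?_, ?_, ?_, ?_⟩
      · rw [hc' i (by omega)]
        refine (hcq _).trans (inter_subset_left.trans ?_)
        simp [q, hi]
      · rw [hc' _ le_rfl]
        refine (hcq _).trans (inter_subset_left.trans ?_)
        simp [q]
      · rw [disjoint_left]
        intro x hx hx'
        have h1 := hball j (by omega) x hx
        have h2 := hball (m + 1) le_rfl x hx'
        rw [hpi j hj] at h1
        rw [hpm] at h2
        have h3 := dist_triangle_left (z j) (w j) x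
        have h4 : δ ≤ dist (z j) (w j) / 2 := min_le_right _ _
        linarith
      · intro i hi x hx y hy
        have h1 := hball i hi x hx
        have h2 := hball i hi y hy
        have h3 := dist_triangle_right x y (p i)
        have h4 : δ ≤ ε / 2 := min_le_left _ _
        linarith
    refine hYn ⟨c', hgood⟩ p fun i hi => ⟨mem_iInter.1 (hq i hi).1 _, ?_, (hq i hi).2.2⟩
    rw [hc' i hi]
    exact hpc _
  obtain ⟨B, hBm, hAB, hBi⟩ := exists_measurableSet_injOn_of_analyticSet hπ hA hinj
  obtain ⟨z, hz⟩ := hl (W \ B) (hYcm.diff hBm) (by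
    rw [sdiff_eq, compl_inter, compl_compl]
    exact hYc.union (.of_injOn hBm hBi))
  exact (hz j hj).1.2 (hAB ⟨z, fun i hi => ⟨(hz i hi).1.1, (hz i hi).2⟩, rfl⟩)

/-- **Lusin–Novikov**: a countable-to-one continuous map on a Polish space is injective on each
piece of some countable Borel cover. -/
theorem isSigmaInjOn_univ_of_countable_fibers [TopologicalSpace Z] [PolishSpace Z]
    [MeasurableSpace Z] [BorelSpace Z] [TopologicalSpace X] [T2Space X] {π : Z → X}
    (hπ : Continuous π) (hc : ∀ x, (π ⁻¹' {x}).Countable) : IsSigmaInjOn π univ := by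
  let := TopologicalSpace.upgradeIsCompletelyMetrizable Z
  by_contra hsmall
  have h0 : IsLargeBox π 0 (fun _ => univ) := by
    intro Y hY hs
    have hne : Y.Nonempty := by
      by_contra hne
      rw [not_nonempty_iff_eq_empty] at hne
      exact hsmall (by simpa [hne] using hs)
    obtain ⟨y, hy⟩ := hne
    refine ⟨fun _ => y, fun i _ => ⟨hy, mem_univ _, rfl⟩⟩
  have hstep : ∀ (m : ℕ) (a : ℕ → Set Z), ∃ b : ℕ → Set Z,
      (∀ i, IsOpen (a i)) → IsLargeBox π m a →
      (∀ i, IsOpen (b i)) ∧ IsLargeBox π (m + 1) b ∧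
      (∀ i ≤ m, closure (b i) ⊆ a i) ∧ closure (b (m + 1)) ⊆ a m.unpair.1 ∧
      Disjoint (b m.unpair.1) (b (m + 1)) ∧
      ∀ i ≤ m + 1, ∀ x ∈ b i, ∀ y ∈ b i, dist x y ≤ (1 / 2 : ℝ) ^ m := by
    intro m a
    by_cases h : (∀ i, IsOpen (a i)) ∧ IsLargeBox π m a
    · obtain ⟨b, hb⟩ := h.2.exists_split hπ h.1 (Nat.unpair_left_le m)
        (ε := (1 / 2 : ℝ) ^ m) (by positivity)
      exact ⟨b, fun _ _ => hb⟩
    · exact ⟨a, fun h1 h2 => absurd ⟨h1, h2⟩ h⟩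
  choose next hnext using hstep
  let a : ℕ → ℕ → Set Z := fun m => Nat.rec (fun _ => univ) next m
  have ha : ∀ m, (∀ i, IsOpen (a m i)) ∧ IsLargeBox π m (a m) := by
    intro m
    induction m with
    | zero => exact ⟨fun _ => isOpen_univ, h0⟩
    | succ m ih => exact ⟨(hnext m _ ih.1 ih.2).1, (hnext m _ ih.1 ih.2).2.1⟩
  have hrel := fun m => (hnext m _ (ha m).1 (ha m).2).2.2
  have hmono : ∀ i m k, i ≤ m → m ≤ k → a k i ⊆ a m i := by
    intro i m k him hmk
    induction k, hmk using Nat.le_induction with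
    | base => exact Subset.rfl
    | succ k hk ih => exact (subset_closure.trans ((hrel k).1 i (him.trans hk))).trans ih
  have hz : ∀ m, ∃ z : ℕ → Z, ∀ i ≤ m, z i ∈ a m i ∧ π (z i) = π (z 0) := by
    intro m
    obtain ⟨z, hz⟩ := (ha m).2 univ MeasurableSet.univ ⟨fun _ => ∅, by simp, by simp, by simp⟩
    exact ⟨z, fun i hi => (hz i hi).2⟩
  choose z hz using hz
  have hhalf : Filter.Tendsto (fun m : ℕ => (1 / 2 : ℝ) ^ m) Filter.atTop (𝓝 0) :=
    tendsto_pow_atTop_nhds_zero_of_lt_one (by norm_num) (by norm_num)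
  have hlim : ∀ i, ∃ ζ, Filter.Tendsto (fun m => z m i) Filter.atTop (𝓝 ζ) := by
    intro i
    refine cauchySeq_tendsto_of_complete (Metric.cauchySeq_iff'.2 fun ε hε => ?_)
    obtain ⟨N, hN⟩ := (hhalf.eventually (gt_mem_nhds hε)).exists
    refine ⟨N + i + 1, fun n hn => ?_⟩
    have h := (hrel (N + i)).2.2.2 i (by omega) (z n i)
      (hmono i _ n (by omega) hn (hz n i (by omega)).1) (z (N + i + 1) i) (hz (N + i + 1) i (by omega)).1
    refine (h.trans ?_).trans_lt hN
    exact pow_le_pow_of_le_one (by norm_num) (by norm_num) (by omega)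
  choose ζ hζ using hlim
  have hmem : ∀ i m, i ≤ m → ζ i ∈ a m i := by
    intro i m him
    refine (hrel m).1 i him (mem_closure_of_tendsto (hζ i) ?_)
    filter_upwards [Filter.eventually_ge_atTop (m + 1)] with n hn
    exact hmono i (m + 1) n (by omega) hn (hz n i (by omega)).1
  have hfib : ∀ i, π (ζ i) = π (ζ 0) := by
    intro i
    refine tendsto_nhds_unique ((hπ.tendsto _).comp (hζ i))
      (((hπ.tendsto _).comp (hζ 0)).congr' ?_)
    filter_upwards [Filter.eventually_ge_atTop i] with n hn
    exact (hz n i hn).2.symm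
  have hpre : Preperfect (range ζ) := by
    rw [preperfect_iff_nhds]
    rintro _ ⟨j, rfl⟩ U hU
    obtain ⟨ε, hε, hεU⟩ := Metric.mem_nhds_iff.1 hU
    obtain ⟨N, hN⟩ := (hhalf.eventually (gt_mem_nhds hε)).exists
    have hm : N + 1 ≤ Nat.pair j (N + 1) := Nat.right_le_pair _ _
    have hjm : j ≤ Nat.pair j (N + 1) := Nat.left_le_pair _ _
    have hu : (Nat.pair j (N + 1)).unpair.1 = j := by simp
    set m := Nat.pair j (N + 1)
    obtain ⟨-, h2, h3, -⟩ := hrel m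
    rw [hu] at h2 h3
    have hm1 : ζ (m + 1) ∈ a (m + 1) (m + 1) := hmem (m + 1) (m + 1) le_rfl
    refine ⟨ζ (m + 1), ⟨hεU ?_, mem_range_self _⟩, fun heq => ?_⟩
    · obtain ⟨k, hk⟩ : ∃ k, m = k + 1 := ⟨m - 1, by omega⟩
      have hd := (hrel k).2.2.2 j (by omega) (ζ (m + 1))
        (by have := h2 (subset_closure hm1); rwa [hk] at this ⊢)
        (ζ j) (by rw [hk] at hjm; exact hmem j _ hjm)
      refine (hd.trans ?_).trans_lt hN
      exact pow_le_pow_of_le_one (by norm_num) (by norm_num) (by omega)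
    · refine disjoint_left.1 h3 (hmem j (m + 1) (by omega)) ?_
      rw [← heq]
      exact hm1
  obtain ⟨f, hf, -, hfi⟩ := hpre.perfect_closure.exists_nat_bool_injection
    (range_nonempty ζ).closure
  have hsub : range f ⊆ π ⁻¹' {π (ζ 0)} := by
    refine hf.trans (closure_minimal ?_ (isClosed_singleton.preimage hπ))
    rintro _ ⟨i, rfl⟩
    exact hfib i
  have hcount : (range f).Countable := (hc _).mono hsub
  have : Countable (ℕ → Bool) := by
    rw [← image_univ] at hcount
    exact countable_univ_iff.1 (countable_of_injective_of_countable_image hfi.injOn hcount)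
  obtain ⟨e, he⟩ := exists_surjective_nat (ℕ → Bool)
  obtain ⟨n, hn⟩ := he fun n => !(e n n)
  simpa using congrFun hn n

end LusinNovikov

section FeldmanMoore

variable {X : Type*} [MeasurableSpace X] [StandardBorelSpace X] {E : X → X → Prop}

/-- The classes of a countable Borel equivalence relation are enumerated by countably many Borel
functions. -/
theorem exists_measurable_enumeration (hEq : Equivalence E)
    (hBorel : MeasurableSet {p : X × X | E p.1 p.2}) (hCtble : ∀ x, {y | E x y}.Countable) :
    ∃ f : ℕ → X → X, (∀ n, Measurable (f n)) ∧ ∀ x y, E x y ↔ ∃ n, f n x = y := by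
  obtain ⟨τ, _, _⟩ := StandardBorelSpace.polish (α := X)
  let Z := {p : X × X | E p.1 p.2}
  have hZ : StandardBorelSpace Z := hBorel.standardBorel
  let π : Z → X := fun p => p.1.1
  have hπ : Measurable π := measurable_fst.comp measurable_subtype_coe
  have hcount : ∀ x, (π ⁻¹' {x}).Countable := by
    intro x
    have hinj : InjOn (fun p : Z => p.1.2) (π ⁻¹' {x}) := by
      rintro ⟨⟨x₁, y₁⟩, h₁⟩ hx₁ ⟨⟨x₂, y₂⟩, h₂⟩ hx₂ h
      simp only [mem_preimage, mem_singleton_iff, π] at hx₁ hx₂ h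
      subst hx₁ hx₂ h
      rfl
    refine countable_of_injective_of_countable_image hinj ((hCtble x).mono ?_)
    rintro _ ⟨⟨⟨x₁, y₁⟩, h₁⟩, hx₁, rfl⟩
    simp only [mem_preimage, mem_singleton_iff, π] at hx₁
    subst hx₁
    exact h₁
  have hσ : IsSigmaInjOn π univ := by
    obtain ⟨τZ, bZ, pZ⟩ := hZ.polish
    obtain ⟨t', hle, hc, hp⟩ := hπ.exists_continuous
    have hb : @BorelSpace Z t' _ :=
      @BorelSpace.mk _ t' _ (bZ.measurable_eq.trans (borel_eq_borel_of_le hp pZ hle).symm)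
    exact @isSigmaInjOn_univ_of_countable_fibers Z X t' hp _ hb τ _ π hc hcount
  obtain ⟨B, hBm, hBi, hB⟩ := hσ
  have hemb : ∀ n, MeasurableEmbedding (fun p : B n => π p) := fun n => by
    have := (hBm n).standardBorel
    exact (hπ.comp measurable_subtype_coe).measurableEmbedding (hBi n).injective
  refine ⟨fun n => Function.extend (fun p : B n => π p) (fun p : B n => p.1.1.2) id,
    fun n => (hemb n).measurable_extend
      ((measurable_snd.comp measurable_subtype_coe).comp measurable_subtype_coe) measurable_id,
    fun x y => ⟨fun h => ?_, ?_⟩⟩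
  · obtain ⟨n, hn⟩ := mem_iUnion.1 (hB (mem_univ (⟨(x, y), h⟩ : Z)))
    exact ⟨n, (hemb n).injective.extend_apply _ _ (⟨⟨(x, y), h⟩, hn⟩ : B n)⟩
  · rintro ⟨n, rfl⟩
    dsimp only
    by_cases h : ∃ p : B n, π p = x
    · obtain ⟨p, rfl⟩ := h
      rw [(hemb n).injective.extend_apply]
      exact p.1.2
    · rw [Function.extend_apply' _ _ _ h]
      exact hEq.refl x

/-- **Feldman–Moore**: a countable Borel equivalence relation is the union of the graphs of
countably many Borel involutions. -/
theorem exists_measurable_involutive (hEq : Equivalence E)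
    (hBorel : MeasurableSet {p : X × X | E p.1 p.2}) (hCtble : ∀ x, {y | E x y}.Countable) :
    ∃ γ : ℕ → X → X, (∀ n, Measurable (γ n)) ∧ (∀ n, Function.Involutive (γ n)) ∧
      ∀ x y, E x y ↔ ∃ n, γ n x = y := by
  classical
  obtain ⟨f, hfm, hfE⟩ := exists_measurable_enumeration hEq hBorel hCtble
  obtain ⟨r, hr⟩ := exists_measurableEmbedding_real X
  let D : ℕ × ℕ × ℚ → Set X := fun i =>
    {x | r x < i.2.2 ∧ (i.2.2 : ℝ) < r (f i.1 x) ∧ r (f i.2.1 (f i.1 x)) = r x}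
  let R : ℕ × ℕ × ℚ → Set X := fun i =>
    {y | (i.2.2 : ℝ) < r y ∧ r (f i.2.1 y) < i.2.2 ∧ r (f i.1 (f i.2.1 y)) = r y}
  have hD : ∀ i, MeasurableSet (D i) := fun i =>
    (measurableSet_lt hr.measurable measurable_const).inter
      ((measurableSet_lt measurable_const (hr.measurable.comp (hfm _))).inter
        (measurableSet_eq_fun (hr.measurable.comp ((hfm _).comp (hfm _))) hr.measurable))
  have hR : ∀ i, MeasurableSet (R i) := fun i =>
    (measurableSet_lt measurable_const hr.measurable).inter
      ((measurableSet_lt (hr.measurable.comp (hfm _)) measurable_const).inter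
        (measurableSet_eq_fun (hr.measurable.comp ((hfm _).comp (hfm _))) hr.measurable))
  let g : ℕ × ℕ × ℚ → X → X := fun i x =>
    if x ∈ D i then f i.1 x else if x ∈ R i then f i.2.1 x else x
  have hgD : ∀ i, ∀ x ∈ D i, g i x = f i.1 x := fun i x hx => if_pos hx
  have hDR : ∀ i, ∀ x ∈ R i, x ∉ D i := fun i x hx hx' => lt_asymm hx.1 hx'.1
  have hgR : ∀ i, ∀ x ∈ R i, g i x = f i.2.1 x := fun i x hx =>
    (if_neg (hDR i x hx)).trans (if_pos hx)
  have hfD : ∀ i, ∀ x ∈ D i, f i.1 x ∈ R i ∧ f i.2.1 (f i.1 x) = x := fun i x hx => by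
    have h := hr.injective hx.2.2
    refine ⟨⟨hx.2.1, ?_, ?_⟩, h⟩ <;> rw [h]
    exact hx.1
  have hfR : ∀ i, ∀ x ∈ R i, f i.2.1 x ∈ D i ∧ f i.1 (f i.2.1 x) = x := fun i x hx => by
    have h := hr.injective hx.2.2
    refine ⟨⟨hx.2.1, ?_, ?_⟩, h⟩ <;> rw [h]
    exact hx.1
  have hgm : ∀ i, Measurable (g i) := fun i =>
    Measurable.ite (hD i) (hfm _) (Measurable.ite (hR i) (hfm _) measurable_id)
  have hgi : ∀ i, Function.Involutive (g i) := by
    intro i x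
    by_cases hxD : x ∈ D i
    · rw [hgD i x hxD, hgR i _ (hfD i x hxD).1, (hfD i x hxD).2]
    by_cases hxR : x ∈ R i
    · rw [hgR i x hxR, hgD i _ (hfR i x hxR).1, (hfR i x hxR).2]
    have : g i x = x := by simp [g, hxD, hxR]
    rw [this, this]
  have hgE : ∀ i x, E x (g i x) := by
    intro i x
    dsimp only [g]
    split_ifs
    exacts [(hfE _ _).2 ⟨_, rfl⟩, (hfE _ _).2 ⟨_, rfl⟩, hEq.refl x]
  have hEg : ∀ x y, E x y → r x < r y → ∃ i, x ∈ D i ∧ f i.1 x = y := by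
    intro x y h hlt
    obtain ⟨q, hq₁, hq₂⟩ := exists_rat_btwn hlt
    obtain ⟨n, hn⟩ := (hfE x y).1 h
    obtain ⟨m, hm⟩ := (hfE y x).1 (hEq.symm h)
    exact ⟨(n, m, q), ⟨hq₁, by simpa [hn] using hq₂, by simp [hn, hm]⟩, hn⟩
  obtain ⟨e, he⟩ := exists_surjective_nat (Option (ℕ × ℕ × ℚ))
  refine ⟨fun n => (e n).elim id g, fun n => ?_, fun n => ?_, fun x y => ⟨fun h => ?_, ?_⟩⟩
  · dsimp only
    cases e n
    exacts [measurable_id, hgm _]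
  · dsimp only
    cases e n
    exacts [fun _ => rfl, hgi _]
  · rcases lt_trichotomy (r x) (r y) with hlt | heq | hgt
    · obtain ⟨i, hi, hy⟩ := hEg x y h hlt
      obtain ⟨n, hn⟩ := he (some i)
      exact ⟨n, by simp [hn, hgD i x hi, hy]⟩
    · obtain ⟨n, hn⟩ := he none
      exact ⟨n, by simpa [hn] using hr.injective heq⟩
    · obtain ⟨i, hi, hy⟩ := hEg y x (hEq.symm h) hgt
      obtain ⟨n, hn⟩ := he (some i)
      refine ⟨n, ?_⟩
      subst hy
      simp [hn, hgR i _ (hfD i y hi).1, (hfD i y hi).2]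
  · rintro ⟨n, rfl⟩
    dsimp only
    cases e n
    exacts [hEq.refl x, hgE _ x]

/-- Countably many Borel self-maps are simultaneously continuous for some compatible Polish
topology. -/
theorem exists_polishSpace_forall_continuous {γ : ℕ → X → X} (hγ : ∀ n, Measurable (γ n)) :
    ∃ t : TopologicalSpace X, @PolishSpace X t ∧ @BorelSpace X t _ ∧
      ∀ n, @Continuous X X t t (γ n) := by
  let T := {t : TopologicalSpace X // @PolishSpace X t ∧ @BorelSpace X t _}
  have step : ∀ t : T, ∃ t' : T, t'.1 ≤ t.1 ∧ ∀ n, @Continuous X X t'.1 t.1 (γ n) := by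
    rintro ⟨t, hp, hb⟩
    have h : ∀ n, ∃ t' : TopologicalSpace X, t' ≤ t ∧ @Continuous X X t' t (γ n) ∧
      @PolishSpace X t' := fun n => (hγ n).exists_continuous
    choose s hs hsc hsp using h
    obtain ⟨t', ht's, ht't, ht'p⟩ := PolishSpace.exists_polishSpace_forall_le s hs hsp
    refine ⟨⟨t', ht'p, @BorelSpace.mk _ t' _
      (hb.measurable_eq.trans (borel_eq_borel_of_le ht'p hp ht't).symm)⟩, ht't, fun n => ?_⟩
    exact continuous_le_dom (ht's n) (hsc n)
  choose next hle hcont using step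
  obtain ⟨t₀, hb₀, hp₀⟩ := StandardBorelSpace.polish (α := X)
  let τ : ℕ → T := fun n => Nat.rec ⟨t₀, hp₀, hb₀⟩ (fun _ t => next t) n
  have hτ0 : ∀ n, (τ n).1 ≤ (τ 0).1 := by
    intro n
    induction n with
    | zero => exact le_rfl
    | succ n ih => exact (hle (τ n)).trans ih
  have hp : @PolishSpace X (⨅ n, (τ n).1) := PolishSpace.iInf ⟨0, hτ0⟩ fun n => (τ n).2.1
  refine ⟨⨅ n, (τ n).1, hp, @BorelSpace.mk _ (_) _ (hb₀.measurable_eq.trans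
    (borel_eq_borel_of_le hp hp₀ (iInf_le (fun n => (τ n).1) 0)).symm), fun n => ?_⟩
  refine continuous_iInf_rng.2 fun k => ?_
  exact continuous_iInf_dom (i := k + 1) (hcont (τ k) n)

/-- If every class has a point isolated in the class, then the relation is smooth. -/
theorem exists_measurable_real_of_isolated [TopologicalSpace X] [PolishSpace X] [BorelSpace X]
    (hEq : Equivalence E) {γ : ℕ → X → X} (hγ : ∀ n, Measurable (γ n))
    (hE : ∀ x y, E x y ↔ ∃ n, γ n x = y)
    (hiso : ∀ x, ∃ y, E x y ∧ ∃ U, IsOpen U ∧ y ∈ U ∧ ∀ z ∈ U, E x z → z = y) :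
    ∃ f : X → ℝ, Measurable f ∧ ∀ x y, E x y ↔ f x = f y := by
  classical
  rcases isEmpty_or_nonempty X with hX | hX
  · exact ⟨fun _ => 0, measurable_const, fun x => isEmptyElim x⟩
  have hB := TopologicalSpace.isBasis_countableBasis X
  have : Nonempty (TopologicalSpace.countableBasis X) := by
    obtain ⟨t, ht, -⟩ := hB.exists_subset_of_mem_open (mem_univ hX.some) isOpen_univ
    exact ⟨⟨t, ht⟩⟩
  obtain ⟨e, he⟩ := exists_surjective_nat (TopologicalSpace.countableBasis X)
  let U : ℕ → Set X := fun n => e n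
  have hUm : ∀ n, MeasurableSet (U n) := fun n => (hB.isOpen (e n).2).measurableSet
  let p : ℕ → X → Prop := fun n x => (∃ i, γ i x ∈ U n) ∧
    ∀ i j, γ i x ∈ U n → γ j x ∈ U n → γ i x = γ j x
  have hp : ∀ n x, p n x ↔ (∃ y ∈ U n, E x y) ∧
      ∀ y ∈ U n, ∀ z ∈ U n, E x y → E x z → y = z := by
    intro n x
    simp only [p, hE]
    constructor
    · rintro ⟨⟨i, hi⟩, h⟩
      refine ⟨⟨_, hi, i, rfl⟩, ?_⟩
      rintro _ hy _ hz ⟨i, rfl⟩ ⟨j, rfl⟩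
      exact h i j hy hz
    · rintro ⟨⟨_, hi, i, rfl⟩, h⟩
      exact ⟨⟨i, hi⟩, fun i j hi hj => h _ hi _ hj ⟨i, rfl⟩ ⟨j, rfl⟩⟩
  have hpm : ∀ n, MeasurableSet {x | p n x} := by
    intro n
    have : {x | p n x} = (⋃ i, γ i ⁻¹' U n) ∩ ⋂ i, ⋂ j,
        ((γ i ⁻¹' U n)ᶜ ∪ ((γ j ⁻¹' U n)ᶜ ∪ {x | γ i x = γ j x})) := by
      ext x
      simp [p, imp_iff_not_or]
    rw [this]
    exact (MeasurableSet.iUnion fun i => hγ i (hUm n)).inter (MeasurableSet.iInter fun i =>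
      MeasurableSet.iInter fun j => (hγ i (hUm n)).compl.union
        ((hγ j (hUm n)).compl.union (measurableSet_eq_fun (hγ i) (hγ j))))
  have hpex : ∀ x, ∃ n, p n x := by
    intro x
    obtain ⟨y, hxy, V, hV, hyV, hVy⟩ := hiso x
    obtain ⟨t, ht, hyt, htV⟩ := hB.exists_subset_of_mem_open hyV hV
    obtain ⟨n, hn⟩ := he ⟨t, ht⟩
    have hUn : U n = t := by simp [U, hn]
    refine ⟨n, (hp n x).2 ⟨⟨y, hUn ▸ hyt, hxy⟩, ?_⟩⟩
    rw [hUn]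
    intro z hz w hw hxz hxw
    rw [hVy z (htV hz) hxz, hVy w (htV hw) hxw]
  have hN : Measurable fun x => Nat.find (hpex x) := measurable_find hpex hpm
  have hex : ∀ x, ∃ i, γ i x ∈ U (Nat.find (hpex x)) := fun x => (Nat.find_spec (hpex x)).1
  let s : X → X := fun x => γ (Nat.find (hex x)) x
  have hs : Measurable s := by
    refine Measurable.find (p := fun i x => γ i x ∈ U (Nat.find (hpex x))) hγ (fun i => ?_) hex
    have : {x | γ i x ∈ U (Nat.find (hpex x))} =
        ⋃ n, {x | Nat.find (hpex x) = n} ∩ γ i ⁻¹' U n := by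
      ext x
      simp
    rw [this]
    exact MeasurableSet.iUnion fun n => (hN (measurableSet_singleton n)).inter (hγ i (hUm n))
  have hsE : ∀ x, E x (s x) := fun x => (hE _ _).2 ⟨_, rfl⟩
  have hsU : ∀ x, s x ∈ U (Nat.find (hpex x)) := fun x => Nat.find_spec (hex x)
  have hinv : ∀ x y, E x y → s x = s y := by
    intro x y hxy
    have hpxy : ∀ n, p n x ↔ p n y := by
      intro n
      have hxy' : ∀ z, E x z ↔ E y z := fun z =>
        ⟨hEq.trans (hEq.symm hxy), hEq.trans hxy⟩
      simp only [hp, hxy']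
    have hfind : Nat.find (hpex x) = Nat.find (hpex y) := Nat.find_congr' (hpxy _)
    refine ((hp _ _).1 (Nat.find_spec (hpex x))).2 _ (hsU x) _ ?_ (hsE x) (hEq.trans hxy (hsE y))
    rw [hfind]
    exact hsU y
  obtain ⟨r, hr⟩ := exists_measurableEmbedding_real X
  refine ⟨r ∘ s, hr.measurable.comp hs, fun x y => ⟨fun h => congrArg r (hinv x y h), fun h => ?_⟩⟩
  have h' : s x = s y := hr.injective h
  exact hEq.trans (hsE x) (h' ▸ hEq.symm (hsE y))

end FeldmanMoore

section CantorScheme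

variable {X : Type*} {E : X → X → Prop}

theorem exists_open_moved_off_itself [MetricSpace X] {γ : ℕ → X ≃ₜ X} {x₀ : X}
    (hx₀ : ∀ y, E x₀ y → ∀ U, IsOpen U → y ∈ U → ∃ n, γ n y ∈ U ∧ γ n y ≠ y)
    {V : Set X} (hV : IsOpen V) (hy : ∃ y ∈ V, E x₀ y) {S : Set (X ≃ₜ X)} (hS : S.Finite)
    {ε : ℝ} (hε : 0 < ε) :
    ∃ (V' : Set X) (k : ℕ), IsOpen V' ∧ (∃ y ∈ V', E x₀ y) ∧ closure V' ⊆ V ∧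
      γ k '' closure V' ⊆ V ∧ Disjoint V' (γ k '' V') ∧
      ∀ w ∈ S, ∀ p ∈ V', ∀ q ∈ V', dist (w p) (w q) ≤ ε ∧ dist (w (γ k p)) (w (γ k q)) ≤ ε := by
  obtain ⟨y, hyV, hy⟩ := hy
  obtain ⟨k, hkV, hk⟩ := hx₀ y hy V hV hyV
  obtain ⟨A, B, hA, hB, hkA, hyB, hAB⟩ := t2_separation hk
  have hsmall : ∀ g : X ≃ₜ X, ∀ᶠ p in 𝓝 y, dist (g p) (g y) < ε / 2 := fun g =>
    g.continuous.continuousAt (Metric.ball_mem_nhds _ (half_pos hε))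
  have hev : ∀ᶠ p in 𝓝 y, (p ∈ V ∧ p ∈ B) ∧ (γ k p ∈ V ∧ γ k p ∈ A) ∧
      ∀ w ∈ S, dist (w p) (w y) < ε / 2 ∧ dist ((w * γ k) p) ((w * γ k) y) < ε / 2 := by
    have h₁ : ∀ᶠ p in 𝓝 y, p ∈ V ∧ p ∈ B := (hV.inter hB).mem_nhds ⟨hyV, hyB⟩
    have h₂ : ∀ᶠ p in 𝓝 y, γ k p ∈ V ∧ γ k p ∈ A :=
      (γ k).continuous.continuousAt ((hV.inter hA).mem_nhds ⟨hkV, hkA⟩)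
    exact h₁.and (h₂.and
      ((Filter.eventually_all_finite hS).2 fun w _ => (hsmall w).and (hsmall (w * γ k))))
  obtain ⟨V', hV', hyV', hsub⟩ :=
    TopologicalSpace.isTopologicalBasis_opens.exists_closure_subset hev
  refine ⟨V', k, hV', ⟨y, hyV', hy⟩, fun p hp => (hsub hp).1.1, ?_, ?_, ?_⟩
  · rintro _ ⟨p, hp, rfl⟩
    exact (hsub hp).2.1.1
  · rw [disjoint_left]
    rintro _ hp ⟨p, hp', rfl⟩
    exact disjoint_left.1 hAB (hsub (subset_closure hp')).2.1.2 (hsub (subset_closure hp)).1.2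
  · intro w hw p hp q hq
    have h₁ := (hsub (subset_closure hp)).2.2 w hw
    have h₂ := (hsub (subset_closure hq)).2.2 w hw
    have h₃ := dist_triangle_right (w p) (w q) (w y)
    have h₄ := dist_triangle_right (w (γ k p)) (w (γ k q)) (w (γ k y))
    simp only [Homeomorph.mul_apply] at h₁ h₂
    constructor <;> linarith

/-- If some class accumulates at each of its points, then eventual equality on `2^ℕ` maps
injectively and Borel measurably into `E`. -/
theorem exists_measurable_injective_of_eventuallyEq [TopologicalSpace X] [PolishSpace X]
    [MeasurableSpace X] [BorelSpace X] (hEq : Equivalence E) {γ : ℕ → X ≃ₜ X}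
    (hγ : ∀ n x, E x (γ n x)) {x₀ : X}
    (hx₀ : ∀ y, E x₀ y → ∀ U, IsOpen U → y ∈ U → ∃ n, γ n y ∈ U ∧ γ n y ≠ y) :
    ∃ h : (ℕ → Bool) → X, Measurable h ∧ Function.Injective h ∧
      ∀ u v, (∀ᶠ n in atTop, u n = v n) → E (h u) (h v) := by
  let := TopologicalSpace.upgradeIsCompletelyMetrizable X
  have step : ∀ (n : ℕ) (s : Set X × Set (X ≃ₜ X)), ∃ (V' : Set X) (k : ℕ),
      IsOpen s.1 → (∃ y ∈ s.1, E x₀ y) → s.2.Finite →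
      IsOpen V' ∧ (∃ y ∈ V', E x₀ y) ∧ closure V' ⊆ s.1 ∧
      γ k '' closure V' ⊆ s.1 ∧ Disjoint V' (γ k '' V') ∧
      ∀ w ∈ s.2, ∀ p ∈ V', ∀ q ∈ V',
        dist (w p) (w q) ≤ (1 / 2 : ℝ) ^ n ∧ dist (w (γ k p)) (w (γ k q)) ≤ (1 / 2 : ℝ) ^ n := by
    intro n s
    by_cases h : IsOpen s.1 ∧ (∃ y ∈ s.1, E x₀ y) ∧ s.2.Finite
    · obtain ⟨V', k, hVk⟩ := exists_open_moved_off_itself hx₀ h.1 h.2.1 h.2.2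
        (ε := (1 / 2 : ℝ) ^ n) (by positivity)
      exact ⟨V', k, fun _ _ _ => hVk⟩
    · exact ⟨∅, 0, fun h₁ h₂ h₃ => absurd ⟨h₁, h₂, h₃⟩ h⟩
  choose nextV nextK hnext using step
  let s : ℕ → Set X × Set (X ≃ₜ X) := fun n => Nat.rec (univ, {1})
    (fun n s => (nextV n s, s.2 ∪ (fun w => w * γ (nextK n s)) '' s.2)) n
  let V : ℕ → Set X := fun n => (s n).1
  let S : ℕ → Set (X ≃ₜ X) := fun n => (s n).2
  let k : ℕ → ℕ := fun n => nextK n (s n)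
  have hs : ∀ n, IsOpen (V n) ∧ (∃ y ∈ V n, E x₀ y) ∧ (S n).Finite := by
    intro n
    induction n with
    | zero => exact ⟨isOpen_univ, ⟨x₀, mem_univ _, hEq.refl _⟩, finite_singleton _⟩
    | succ n ih =>
      have h := hnext n (s n) ih.1 ih.2.1 ih.2.2
      exact ⟨h.1, h.2.1, ih.2.2.union (ih.2.2.image _)⟩
  have hrel : ∀ n, closure (V (n + 1)) ⊆ V n ∧ γ (k n) '' closure (V (n + 1)) ⊆ V n ∧
      Disjoint (V (n + 1)) (γ (k n) '' V (n + 1)) ∧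
      ∀ w ∈ S n, ∀ p ∈ V (n + 1), ∀ q ∈ V (n + 1),
        dist (w p) (w q) ≤ (1 / 2 : ℝ) ^ n ∧
        dist (w (γ (k n) p)) (w (γ (k n) q)) ≤ (1 / 2 : ℝ) ^ n := fun n =>
    (hnext n (s n) (hs n).1 (hs n).2.1 (hs n).2.2).2.2
  let σ : ℕ → Bool → X ≃ₜ X := fun n b => if b then γ (k n) else 1
  let W : ℕ → (ℕ → Bool) → X ≃ₜ X := fun n u => Nat.rec 1 (fun n w => w * σ n (u n)) n
  have hWs : ∀ n u, W (n + 1) u = W n u * σ n (u n) := fun _ _ => rfl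
  have hWS : ∀ n u, W n u ∈ S n := by
    intro n u
    induction n with
    | zero => exact mem_singleton _
    | succ n ih =>
      rw [hWs]
      cases u n
      · exact Or.inl ih
      · exact Or.inr ⟨_, ih, rfl⟩
  have hσV : ∀ n b, σ n b '' closure (V (n + 1)) ⊆ V n := by
    intro n b
    cases b
    · rintro _ ⟨p, hp, rfl⟩
      exact (hrel n).1 hp
    · exact (hrel n).2.1
  have hσd : ∀ n, ∀ w ∈ S n, ∀ b, ∀ p ∈ V (n + 1), ∀ q ∈ V (n + 1),
      dist (w (σ n b p)) (w (σ n b q)) ≤ (1 / 2 : ℝ) ^ n := by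
    intro n w hw b p hp q hq
    cases b
    · exact ((hrel n).2.2.2 w hw p hp q hq).1
    · exact ((hrel n).2.2.2 w hw p hp q hq).2
  have hO : ∀ n u, closure (W (n + 1) u '' V (n + 1)) ⊆ W n u '' V n := by
    intro n u
    rw [← Homeomorph.image_closure, hWs]
    rintro _ ⟨p, hp, rfl⟩
    exact ⟨_, hσV n (u n) ⟨p, hp, rfl⟩, rfl⟩
  have hOmono : ∀ u n m, n ≤ m → W m u '' V m ⊆ W n u '' V n := by
    intro u n m hnm
    induction m, hnm using Nat.le_induction with
    | base => exact Subset.rfl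
    | succ m hm ih => exact (subset_closure.trans (hO m u)).trans ih
  have hOd : ∀ n u, ∀ p ∈ W (n + 1) u '' V (n + 1), ∀ q ∈ W (n + 1) u '' V (n + 1),
      dist p q ≤ (1 / 2 : ℝ) ^ n := by
    rintro n u _ ⟨p, hp, rfl⟩ _ ⟨q, hq, rfl⟩
    exact hσd n _ (hWS n u) (u n) p hp q hq
  choose p hp using fun n => (hs n).2.1
  have hhalf : Tendsto (fun m : ℕ => (1 / 2 : ℝ) ^ m) atTop (𝓝 0) :=
    tendsto_pow_atTop_nhds_zero_of_lt_one (by norm_num) (by norm_num)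
  have hlim : ∀ u, ∃ x, Tendsto (fun n => W n u (p n)) atTop (𝓝 x) := by
    intro u
    refine cauchySeq_tendsto_of_complete (Metric.cauchySeq_iff'.2 fun ε hε => ?_)
    obtain ⟨N, hN⟩ := (hhalf.eventually (gt_mem_nhds hε)).exists
    exact ⟨N + 1, fun n hn => (hOd N u _ (hOmono u _ n hn (mem_image_of_mem _ (hp n).1)) _
      (mem_image_of_mem _ (hp (N + 1)).1)).trans_lt hN⟩
  choose h hh using hlim
  have hmem : ∀ u n, h u ∈ W n u '' V n := by
    intro u n
    refine hO n u (mem_closure_of_tendsto (hh u) ?_)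
    filter_upwards [eventually_ge_atTop (n + 1)] with m hm
    exact hOmono u _ m hm (mem_image_of_mem _ (hp m).1)
  have hWE : ∀ n u x, E x (W n u x) := by
    intro n u
    induction n with
    | zero => exact hEq.refl
    | succ n ih =>
      intro x
      rw [hWs]
      refine hEq.trans ?_ (ih (σ n (u n) x))
      cases u n
      exacts [hEq.refl x, hγ _ x]
  refine ⟨h, ?_, ?_, ?_⟩
  · have hWm : ∀ n q, Measurable fun u => W n u q := by
      intro n
      induction n with
      | zero => exact fun _ => measurable_const
      | succ n ih =>
        intro q
        have : (fun u => W (n + 1) u q) =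
            fun u => if u n = true then W n u (γ (k n) q) else W n u q := by
          funext u
          rw [hWs]
          cases hu : u n <;> simp [σ]
        rw [this]
        have hset : MeasurableSet {u : ℕ → Bool | u n = true} :=
          measurableSet_eq_fun (measurable_pi_apply n) measurable_const
        exact Measurable.ite hset (ih _) (ih _)
    exact measurable_of_tendsto_metrizable (fun n => hWm n (p n)) (tendsto_pi_nhds.2 hh)
  · intro u v huv
    by_contra hne
    have hex : ∃ n, u n ≠ v n := Function.ne_iff.1 hne
    classical
    have hn := Nat.find_spec hex
    have hlt : ∀ m < Nat.find hex, u m = v m := fun m hm => not_not.1 (Nat.find_min hex hm)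
    set n := Nat.find hex
    have hW : ∀ m ≤ n, W m u = W m v := by
      intro m hm
      induction m with
      | zero => rfl
      | succ m ih => rw [hWs, hWs, ih (by omega), hlt m (by omega)]
    obtain ⟨a, ha, hau⟩ := hmem u (n + 1)
    obtain ⟨b, hb, hbv⟩ := hmem v (n + 1)
    rw [hWs] at hau hbv
    have hab : σ n (u n) a = σ n (v n) b :=
      (W n u).injective (hau.trans (huv.trans (by rw [← hbv, hW n le_rfl]; rfl)))
    have hd := disjoint_left.1 (hrel n).2.2.1
    cases hu : u n <;> cases hv : v n <;> simp only [hu, hv, ne_eq, not_true_eq_false] at hn hab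
    · exact hd ha ⟨b, hb, hab.symm⟩
    · exact hd hb ⟨a, ha, hab⟩
  · intro u v huv
    obtain ⟨n, hn⟩ := eventually_atTop.1 huv
    have hW : ∀ m, n ≤ m → W m u = W n u * (W n v)⁻¹ * W m v := by
      intro m hm
      induction m, hm using Nat.le_induction with
      | base => simp
      | succ m hm ih => rw [hWs, hWs, ih, hn m hm, mul_assoc]
    have hg : h u = (W n u * (W n v)⁻¹) (h v) := by
      refine tendsto_nhds_unique (hh u) (Tendsto.congr' ?_
        (((W n u * (W n v)⁻¹).continuous.tendsto _).comp (hh v)))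
      filter_upwards [eventually_ge_atTop n] with m hm
      rw [hW m hm]
      rfl
    rw [hg]
    refine hEq.symm (hEq.trans ?_ (hWE n u _))
    have := hEq.symm (hWE n v ((W n v)⁻¹ (h v)))
    simpa using this

end CantorScheme

section Parity

/-- No Borel subset of `2^ℕ` is mapped to its complement by every change of one coordinate. -/
theorem not_forall_flip_mem_iff {A : Set (ℕ → Bool)} (hA : MeasurableSet A) :
    ¬ ∀ u n, Function.update u n (!(u n)) ∈ A ↔ u ∉ A := by
  intro hflip
  let flip : ℕ → (ℕ → Bool) → ℕ → Bool := fun n u => Function.update u n (!(u n))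
  have hc : ∀ n, Continuous (flip n) := fun n =>
    continuous_id.update n ((continuous_of_discreteTopology (f := not)).comp (continuous_apply n))
  have hi : ∀ n, Function.Involutive (flip n) := fun n u => by simp [flip]
  let e : ℕ → (ℕ → Bool) ≃ₜ (ℕ → Bool) := fun n => ⟨(hi n).toPerm, hc n, hc n⟩
  obtain ⟨U, hU, hAU⟩ := hA.residualEq_isOpen
  have hmem : ∀ᶠ u in residual (ℕ → Bool), u ∈ A ↔ u ∈ U := hAU.mem_iff
  have hev : ∀ n, ∀ᶠ u in residual (ℕ → Bool), flip n u ∈ U ↔ u ∉ U := by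
    intro n
    have h := (tendsto_residual_of_isOpenMap (hc n) (e n).isOpenMap).eventually hmem
    filter_upwards [h, hmem] with u h₁ h₂
    rw [← h₁, ← h₂]
    exact hflip u n
  rcases U.eq_empty_or_nonempty with rfl | ⟨u, hu⟩
  · obtain ⟨u, hu⟩ := (dense_of_mem_residual (hev 0)).nonempty
    simp at hu
  · have hlim : Tendsto (fun n => flip n u) atTop (𝓝 u) := by
      refine tendsto_pi_nhds.2 fun i => tendsto_const_nhds.congr' ?_
      filter_upwards [eventually_gt_atTop i] with n hn
      exact (Function.update_of_ne hn.ne _ _).symm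
    obtain ⟨n, hn⟩ := (hlim.eventually (hU.mem_nhds hu)).exists
    obtain ⟨v, ⟨hvU, hvn⟩, hv⟩ := (dense_of_mem_residual (hev n)).inter_open_nonempty
      (U ∩ flip n ⁻¹' U) (hU.inter (hU.preimage (hc n))) ⟨u, hu, hn⟩
    exact (hv.1 hvn) hvU

/-- The parity of the number of `i < n` with `u i = true`. -/
def prefixParity (u : ℕ → Bool) : ℕ → Bool
  | 0 => false
  | n + 1 => xor (prefixParity u n) (u n)

/-- The set of prefix parities of `u`, spread over the even numbers, with its complement spread
over the odd numbers. -/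
def paritySet (u : ℕ → Bool) (n : ℕ) : Bool := xor (prefixParity u (n / 2)) n.bodd

theorem prefixParity_update (u : ℕ → Bool) (n m : ℕ) :
    prefixParity (Function.update u n (!(u n))) m =
      xor (prefixParity u m) (decide (n < m)) := by
  induction m with
  | zero => simp [prefixParity]
  | succ m ih =>
    rw [prefixParity, prefixParity, ih]
    rcases lt_trichotomy n m with h | rfl | h
    · rw [Function.update_of_ne h.ne']
      simp [h, h.trans (Nat.lt_succ_self m)]
    · simp
    · rw [Function.update_of_ne h.ne]
      have h₁ : ¬ n < m := by omega
      have h₂ : ¬ n < m + 1 := by omega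
      simp [h₁, h₂]

theorem eventually_paritySet_update (u : ℕ → Bool) (n : ℕ) :
    ∀ᶠ m in atTop, paritySet (Function.update u n (!(u n))) m = !(paritySet u m) := by
  filter_upwards [eventually_ge_atTop (2 * n + 2)] with m hm
  have h : n < m / 2 := by omega
  simp [paritySet, prefixParity_update, h]

theorem isInfSet_paritySet (u : ℕ → Bool) : IsInfSet (paritySet u) := by
  refine Nat.frequently_atTop_iff_infinite.1 (frequently_atTop.2 fun N => ?_)
  cases h : prefixParity u N
  · exact ⟨2 * N + 1, by omega, by simp [paritySet, show (2 * N + 1) / 2 = N by omega, h]⟩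
  · exact ⟨2 * N, by omega, by simp [paritySet, h]⟩

theorem measurable_paritySet : Measurable paritySet := by
  have hxor : ∀ {f g : (ℕ → Bool) → Bool}, Measurable f → Measurable g →
      Measurable fun u => xor (f u) (g u) := fun hf hg =>
    (Measurable.of_discrete (f := fun b : Bool × Bool => xor b.1 b.2)).comp (hf.prodMk hg)
  have hp : ∀ n, Measurable fun u => prefixParity u n := by
    intro n
    induction n with
    | zero => exact measurable_const
    | succ n ih => exact hxor ih (measurable_pi_apply n)
  exact measurable_pi_iff.2 fun n => hxor (hp _) measurable_const

theorem almostSubset_iff {x y : ℕ → Bool} :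
    AlmostSubset x y ↔ ∀ᶠ n in atTop, x n = true → y n = true := by
  rw [AlmostSubset, ← Nat.cofinite_eq_atTop, eventually_cofinite]
  simp

theorem measurableSet_almostSubset {α : Type*} [MeasurableSpace α] {f g : α → ℕ → Bool}
    (hf : Measurable f) (hg : Measurable g) : MeasurableSet {a | AlmostSubset (f a) (g a)} := by
  have : {a | AlmostSubset (f a) (g a)} =
      ⋃ N, ⋂ n, ⋂ _ : N ≤ n, {a | f a n = true}ᶜ ∪ {a | g a n = true} := by
    ext a
    simp [almostSubset_iff, eventually_atTop, imp_iff_not_or]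
  rw [this]
  exact MeasurableSet.iUnion fun N => MeasurableSet.iInter fun n => MeasurableSet.iInter fun _ =>
    ((measurable_pi_iff.1 hf n) (measurableSet_singleton true)).compl.union
      ((measurable_pi_iff.1 hg n) (measurableSet_singleton true))

/-- Eventual equality on `2^ℕ` does not map injectively into a relation with property `𝗌`. -/
theorem PropertyS.not_injective {X : Type*} [MeasurableSpace X] [StandardBorelSpace X]
    {E : X → X → Prop} (hS : PropertyS E) (hEq : Equivalence E) {γ : ℕ → X → X}
    (hγ : ∀ n, Measurable (γ n)) (hE : ∀ x y, E x y ↔ ∃ n, γ n x = y)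
    {h : (ℕ → Bool) → X} (hm : Measurable h)
    (hE₀ : ∀ u v, (∀ᶠ n in atTop, u n = v n) → E (h u) (h v)) : ¬ Function.Injective h := by
  intro hi
  let Θ : X → ℕ → Bool := Function.extend h paritySet (fun _ _ => true)
  have hΘm : Measurable Θ :=
    (hm.measurableEmbedding hi).measurable_extend measurable_paritySet measurable_const
  have hΘh : ∀ u, Θ (h u) = paritySet u := hi.extend_apply _ _
  have hΘi : ∀ x, IsInfSet (Θ x) := by
    intro x
    by_cases hx : ∃ u, h u = x
    · obtain ⟨u, rfl⟩ := hx
      rw [hΘh]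
      exact isInfSet_paritySet u
    · simp only [Θ, Function.extend_apply' _ _ _ hx]
      simpa [IsInfSet] using infinite_univ
  have hrange : ∀ x, range (fun n => Θ (γ n x)) = Θ '' {y | E x y} := by
    intro x
    ext z
    simp [hE]
  obtain ⟨ψ, hψm, hψi, hψE, hψ⟩ := hS (fun x n => Θ (γ n x))
    (measurable_pi_iff.2 fun n => hΘm.comp (hγ n)) (fun x n => hΘi _) (by
      intro x y hxy
      have hxy' : ∀ z, E x z ↔ E y z := fun z => ⟨hEq.trans (hEq.symm hxy), hEq.trans hxy⟩
      rw [hrange, hrange]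
      simp only [hxy'])
  have hdec : ∀ u, AlmostSubset (ψ (h u)) (paritySet u) ∨
      AlmostSubset (ψ (h u)) (complB (paritySet u)) := by
    intro u
    obtain ⟨n, hn⟩ := (hE (h u) (h u)).1 (hEq.refl _)
    simpa [hn, hΘh] using hψ (h u) n
  refine not_forall_flip_mem_iff
    (measurableSet_almostSubset (hψm.comp hm) measurable_paritySet) fun u n => ?_
  have hψe : ∀ᶠ m in atTop, ψ (h u) m = ψ (h (Function.update u n (!(u n)))) m := by
    refine hψE _ _ (hE₀ _ _ ?_)
    filter_upwards [eventually_gt_atTop n] with m hm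
    rw [Function.update_of_ne hm.ne']
  have hpar := eventually_paritySet_update u n
  have hiff : AlmostSubset (ψ (h (Function.update u n (!(u n)))))
      (paritySet (Function.update u n (!(u n)))) ↔
      AlmostSubset (ψ (h u)) (complB (paritySet u)) := by
    rw [almostSubset_iff, almostSubset_iff]
    refine eventually_congr ?_
    filter_upwards [hψe, hpar] with m h₁ h₂
    rw [h₁, h₂, complB]
  change AlmostSubset _ _ ↔ ¬ AlmostSubset _ _
  simp only [Function.comp_apply]
  rw [hiff]
  refine ⟨fun h₁ h₂ => ?_, (hdec u).resolve_left⟩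
  rw [almostSubset_iff] at h₁ h₂
  obtain ⟨m, hm, h₃, h₄⟩ := ((Nat.frequently_atTop_iff_infinite.2 (hψi (h u))).and_eventually
    (h₁.and h₂)).exists
  have h₅ := h₃ hm
  simp [complB, h₄ hm] at h₅

end Parity

/-- If a countable Borel equivalence relation on a standard Borel space has
property `𝗌`, then it is smooth. -/
theorem smooth_of_propertyS
    {X : Type*} [MeasurableSpace X] [StandardBorelSpace X]
    (E : X → X → Prop) (hEq : Equivalence E)
    (hBorel : MeasurableSet {p : X × X | E p.1 p.2})
    (hCtble : ∀ x, {y | E x y}.Countable)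
    (hS : PropertyS E) :
    ∃ f : X → ℝ, Measurable f ∧ ∀ x y, E x y ↔ f x = f y := by
  obtain ⟨γ, hγm, hγi, hγE⟩ := exists_measurable_involutive hEq hBorel hCtble
  obtain ⟨t, hp, hb, hγc⟩ := exists_polishSpace_forall_continuous hγm
  refine exists_measurable_real_of_isolated hEq hγm hγE ?_
  by_contra hcon
  push Not at hcon
  obtain ⟨x₀, hx₀⟩ := hcon
  let γ' : ℕ → X ≃ₜ X := fun n => ⟨(hγi n).toPerm, hγc n, hγc n⟩
  obtain ⟨h, hm, hi, hE₀⟩ := exists_measurable_injective_of_eventuallyEq hEq (γ := γ') (x₀ := x₀)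
    (fun n x => (hγE _ _).2 ⟨n, rfl⟩) (by
      intro y hy U hU hyU
      obtain ⟨z, hzU, hz, hzy⟩ := hx₀ y hy U hU hyU
      obtain ⟨n, hn⟩ := (hγE y z).1 (hEq.trans (hEq.symm hy) hz)
      subst hn
      exact ⟨n, hzU, hzy⟩)
  exact hS.not_injective hEq hγm hγE hm hE₀ hi
end

section
/- If E is a smooth countable Borel equivalence relation on a standard Borel space X, then E has property 𝗌; in fact, for every Borel homomorphism φ : X → ([ℕ]^ℕ)^ℕ from E to E_set there exists an E-invariant Borel function ψ : X → [ℕ]^ℕ such that for all x ∈ X and n ∈ ℕ, either ψ(x) ⊆* φ(x)(n) or ψ(x) ⊆* ℕ \ φ(x)(n). -/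
open Filter

open Set MeasureTheory

/-- The decreasing infinite sets obtained by deciding one member of `a` after the other. -/
def decidedSet (a : ℕ → ℕ → Bool) : ℕ → ℕ → Prop
  | 0, _ => True
  | n + 1, m => decidedSet a n m ∧
      ((a n m = true) ↔ ∀ N, ∃ k, N ≤ k ∧ decidedSet a n k ∧ a n k = true)

/-- `m` is the least element of the `n`-th decided set that is at least `n`. -/
def IsLeastDecided (a : ℕ → ℕ → Bool) (n m : ℕ) : Prop :=
  n ≤ m ∧ decidedSet a n m ∧ ∀ j, n ≤ j → j < m → ¬ decidedSet a n j

open scoped Classical in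
/-- A pseudo-intersection of the decided sets. -/
noncomputable def unsplitSet (a : ℕ → ℕ → Bool) (m : ℕ) : Bool :=
  decide (∃ n, IsLeastDecided a n m)

theorem decidedSet_infinite (a : ℕ → ℕ → Bool) (n : ℕ) :
    ∀ N, ∃ m, N ≤ m ∧ decidedSet a n m := by
  induction n with
  | zero => exact fun N => ⟨N, le_rfl, trivial⟩
  | succ n ih =>
    intro N
    by_cases h : ∀ N, ∃ k, N ≤ k ∧ decidedSet a n k ∧ a n k = true
    · obtain ⟨k, hk, hd, ha⟩ := h N
      exact ⟨k, hk, hd, iff_of_true ha h⟩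
    · obtain ⟨M, hM⟩ := not_forall.1 h
      obtain ⟨k, hk, hd⟩ := ih (max N M)
      refine ⟨k, le_of_max_le_left hk, hd, iff_of_false (fun ha => ?_) h⟩
      exact hM ⟨k, le_of_max_le_right hk, hd, ha⟩

theorem decidedSet_antitone (a : ℕ → ℕ → Bool) (m : ℕ) : Antitone fun n => decidedSet a n m :=
  antitone_nat_of_succ_le fun _ h => h.1

theorem isInfSet_unsplitSet (a : ℕ → ℕ → Bool) : IsInfSet (unsplitSet a) := by
  classical
  refine Nat.frequently_atTop_iff_infinite.1 (frequently_atTop.2 fun n => ?_)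
  have hex := decidedSet_infinite a n n
  refine ⟨Nat.find hex, (Nat.find_spec hex).1, ?_⟩
  simp only [unsplitSet, decide_eq_true_eq]
  exact ⟨n, (Nat.find_spec hex).1, (Nat.find_spec hex).2,
    fun j hj hlt hd => Nat.find_min hex hlt ⟨hj, hd⟩⟩

theorem finite_unsplitSet_diff_decidedSet (a : ℕ → ℕ → Bool) (n : ℕ) :
    {m | unsplitSet a m = true ∧ ¬ decidedSet a n m}.Finite := by
  have hfin : (⋃ k ∈ Iio n, {m | IsLeastDecided a k m}).Finite := by
    refine (finite_Iio n).biUnion fun k _ => Set.Subsingleton.finite ?_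
    rintro m ⟨h₁, h₂, h₃⟩ m' ⟨h₁', h₂', h₃'⟩
    by_contra hne
    rcases lt_or_gt_of_ne hne with h | h
    · exact h₃' m h₁ h h₂
    · exact h₃ m' h₁' h h₂'
  refine hfin.subset ?_
  rintro m ⟨hm, hd⟩
  obtain ⟨k, hk⟩ : ∃ k, IsLeastDecided a k m := by simpa [unsplitSet] using hm
  refine mem_biUnion (x := k) ?_ hk
  by_contra hkn
  exact hd (decidedSet_antitone a m (not_lt.1 hkn) hk.2.1)

theorem unsplitSet_almostSubset (a : ℕ → ℕ → Bool) (n : ℕ) :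
    AlmostSubset (unsplitSet a) (a n) ∨ AlmostSubset (unsplitSet a) (complB (a n)) := by
  by_cases h : ∀ N, ∃ k, N ≤ k ∧ decidedSet a n k ∧ a n k = true
  · refine .inl ((finite_unsplitSet_diff_decidedSet a (n + 1)).subset ?_)
    rintro m ⟨hm, ha⟩
    refine ⟨hm, fun hd => ?_⟩
    simp [hd.2.2 h] at ha
  · refine .inr ((finite_unsplitSet_diff_decidedSet a (n + 1)).subset ?_)
    rintro m ⟨hm, ha⟩
    refine ⟨hm, fun hd => h (hd.2.1 ?_)⟩
    simpa [complB] using ha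

theorem measurable_decidedSet (n m : ℕ) :
    Measurable fun a : ℕ → ℕ → Bool => decidedSet a n m := by
  have hcoord : ∀ n m, Measurable fun a : ℕ → ℕ → Bool => a n m = true := fun n m =>
    (measurableSet_eq_fun (by fun_prop) measurable_const : MeasurableSet
      {a : ℕ → ℕ → Bool | a n m = true}).mem
  induction n generalizing m with
  | zero => exact measurable_const
  | succ n ih =>
    exact (ih m).and ((hcoord n m).iff (Measurable.forall fun N => Measurable.exists fun k =>
      measurable_const.and ((ih k).and (hcoord n k))))

theorem measurable_unsplitSet : Measurable unsplitSet := by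
  refine measurable_pi_iff.2 fun m => measurable_to_bool ?_
  have h : Measurable fun a => ∃ n, IsLeastDecided a n m :=
    Measurable.exists fun n => measurable_const.and ((measurable_decidedSet n m).and
      (Measurable.forall fun j => measurable_const.imp
        (measurable_const.imp (measurable_decidedSet n j).not)))
  convert h.setOf using 1
  ext a
  simp [unsplitSet]

theorem exists_countable_closed_separating_pairs (X : Type*) [MetricSpace X]
    [TopologicalSpace.SeparableSpace X] {ε : ℝ} (hε : 0 < ε) :
    ∃ P : Set (Set X × Set X), P.Countable ∧
      (∀ p ∈ P, IsClosed p.1 ∧ IsClosed p.2 ∧ Disjoint p.1 p.2 ∧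
        (∀ x ∈ p.1, ∀ y ∈ p.1, dist x y ≤ ε) ∧ ∀ x ∈ p.2, ∀ y ∈ p.2, dist x y ≤ ε) ∧
      ∀ x y, x ≠ y → ∃ p ∈ P, x ∈ p.1 ∧ y ∈ p.2 := by
  obtain ⟨s, hs, hd⟩ := TopologicalSpace.exists_countable_dense X
  let Q : Set (Set X) := ⋃ a ∈ s, range fun m : ℕ => Metric.closedBall a (1 / ((m : ℝ) + 1))
  have hQ : Q.Countable := hs.biUnion fun a _ => countable_range _
  refine ⟨Q ×ˢ Q ∩ {p | IsClosed p.1 ∧ IsClosed p.2 ∧ Disjoint p.1 p.2 ∧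
    (∀ x ∈ p.1, ∀ y ∈ p.1, dist x y ≤ ε) ∧ ∀ x ∈ p.2, ∀ y ∈ p.2, dist x y ≤ ε},
    (hQ.prod hQ).mono inter_subset_left, fun p hp => hp.2, fun x y hxy => ?_⟩
  have hxy' : 0 < dist x y := dist_pos.2 hxy
  obtain ⟨m, hm⟩ := exists_nat_one_div_lt (lt_min (half_pos hε) (div_pos hxy' four_pos))
  have hm₁ := hm.trans_le (min_le_left _ _)
  have hm₂ := hm.trans_le (min_le_right _ _)
  have hpos : 0 < 1 / ((m : ℝ) + 1) := Nat.one_div_pos_of_nat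
  obtain ⟨a, ha, hxa⟩ := hd.exists_dist_lt x hpos
  obtain ⟨b, hb, hyb⟩ := hd.exists_dist_lt y hpos
  have hsmall : ∀ c : X, ∀ x ∈ Metric.closedBall c (1 / ((m : ℝ) + 1)),
      ∀ y ∈ Metric.closedBall c (1 / ((m : ℝ) + 1)), dist x y ≤ ε := by
    intro c x hx y hy
    linarith [dist_triangle_right x y c, Metric.mem_closedBall.1 hx, Metric.mem_closedBall.1 hy]
  refine ⟨(Metric.closedBall a (1 / ((m : ℝ) + 1)), Metric.closedBall b (1 / ((m : ℝ) + 1))),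
    ⟨⟨mem_biUnion ha ⟨m, rfl⟩, mem_biUnion hb ⟨m, rfl⟩⟩, Metric.isClosed_closedBall,
      Metric.isClosed_closedBall, Metric.closedBall_disjoint_closedBall ?_, hsmall a, hsmall b⟩,
    hxa.le, hyb.le⟩
  linarith [dist_triangle4_right x y a b, dist_triangle x a y, dist_triangle a b y,
    dist_comm y b]

theorem exists_measurableSet_superset_injOn {X : Type*} [MetricSpace X] [PolishSpace X]
    [MeasurableSpace X] [BorelSpace X] {f : X → ℝ} (hf : Measurable f) {M : Set X}
    (hM : MeasurableSet M) {T : Set ℝ} (hT : AnalyticSet T) (hinj : InjOn f (M ∩ f ⁻¹' T)) :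
    ∃ B, MeasurableSet B ∧ InjOn f B ∧ M ∩ f ⁻¹' T ⊆ B := by
  obtain ⟨P, hP, hclosed, hsep⟩ := exists_countable_closed_separating_pairs X one_pos
  have hanalytic : ∀ C : Set X, IsClosed C → AnalyticSet (f '' (C ∩ (M ∩ f ⁻¹' T))) := by
    intro C hC
    rw [← inter_assoc, image_inter_preimage, inter_eq_iInter]
    refine AnalyticSet.iInter fun b => ?_
    cases b
    · exact hT
    · exact (hC.measurableSet.inter hM).analyticSet_image hf
  have hborel : ∀ p ∈ P, ∃ Q : Set ℝ, MeasurableSet Q ∧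
      (∀ x ∈ M ∩ f ⁻¹' T, x ∈ p.1 → f x ∈ Q) ∧ ∀ x ∈ M ∩ f ⁻¹' T, x ∈ p.2 → f x ∉ Q := by
    intro p hp
    obtain ⟨h₁, h₂, hdisj, -⟩ := hclosed p hp
    obtain ⟨Q, hsub, hQ, hmeas⟩ := (hanalytic _ h₁).measurablySeparable (hanalytic _ h₂) (by
      rw [Set.disjoint_left]
      rintro _ ⟨x, hx, rfl⟩ ⟨y, hy, hxy⟩
      exact Set.disjoint_left.1 hdisj hx.1 (hinj hy.2 hx.2 hxy ▸ hy.1))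
    exact ⟨Q, hmeas, fun x hx hxp => hsub ⟨x, ⟨hxp, hx⟩, rfl⟩,
      fun x hx hxp => Set.disjoint_left.1 hQ ⟨x, ⟨hxp, hx⟩, rfl⟩⟩
  choose! Q hQ hQ₁ hQ₂ using hborel
  refine ⟨⋂ p ∈ P, ((p.1)ᶜ ∪ f ⁻¹' Q p) ∩ ((p.2)ᶜ ∪ f ⁻¹' (Q p)ᶜ),
    MeasurableSet.biInter hP fun p hp =>
      ((hclosed p hp).1.measurableSet.compl.union (hf (hQ p hp))).inter
        ((hclosed p hp).2.1.measurableSet.compl.union (hf (hQ p hp).compl)), ?_, ?_⟩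
  · intro x hx y hy hxy
    by_contra hne
    obtain ⟨p, hp, hxp, hyp⟩ := hsep x y hne
    have h₁ := ((mem_iInter₂.1 hx p hp).1).resolve_left (not_not.2 hxp)
    have h₂ := ((mem_iInter₂.1 hy p hp).2).resolve_left (not_not.2 hyp)
    exact h₂ (hxy ▸ h₁)
  · intro x hx
    refine mem_iInter₂.2 fun p hp => ⟨?_, ?_⟩
    · exact or_iff_not_imp_left.2 fun h => hQ₁ p hp x hx (not_not.1 h)
    · exact or_iff_not_imp_left.2 fun h => hQ₂ p hp x hx (not_not.1 h)

/-- A countable family of measurable sets on each of which `f` is injective. -/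
structure IsInjFamily {X : Type*} [MeasurableSpace X] (f : X → ℝ) (S : Set (Set X)) : Prop where
  countable : S.Countable
  measurableSet : ∀ s ∈ S, MeasurableSet s
  injOn : ∀ s ∈ S, InjOn f s

/-- The sets `W i`, `i ∈ K`, have points in a common fibre of `f`, even after removal of countably
many measurable sets on which `f` is injective. -/
def FibreLarge {X I : Type*} [MeasurableSpace X] (f : X → ℝ) (K : Set I) (W : I → Set X) : Prop :=
  ∀ S, IsInjFamily f S → ∃ r, ∀ i ∈ K, ∃ x ∈ W i \ ⋃₀ S, f x = r

theorem FibreLarge.exists_split {X I : Type*} [MetricSpace X] [PolishSpace X]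
    [MeasurableSpace X] [BorelSpace X] {f : X → ℝ} (hf : Measurable f) {K : Set I}
    (hK : K.Countable) {W : I → Set X} (hW : ∀ i, IsClosed (W i)) (hlarge : FibreLarge f K W)
    {i : I} (hi : i ∈ K) {ε : ℝ} (hε : 0 < ε) :
    ∃ C : Bool → Set X, (∀ b, IsClosed (C b)) ∧ Disjoint (C true) (C false) ∧
      (∀ b, ∀ x ∈ C b, ∀ y ∈ C b, dist x y ≤ ε) ∧
      ∀ S, IsInjFamily f S → ∃ r, (∀ k ∈ K, ∃ x ∈ W k \ ⋃₀ S, f x = r) ∧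
        ∀ b, ∃ x ∈ (W i ∩ C b) \ ⋃₀ S, f x = r := by
  obtain ⟨P, hP, hPprop, hsep⟩ := exists_countable_closed_separating_pairs X hε
  by_contra hcon
  have hbad : ∀ p ∈ P, ∃ S, IsInjFamily f S ∧ ∀ r, (∀ k ∈ K, ∃ x ∈ W k \ ⋃₀ S, f x = r) →
      ¬ ((∃ x ∈ (W i ∩ p.1) \ ⋃₀ S, f x = r) ∧ ∃ x ∈ (W i ∩ p.2) \ ⋃₀ S, f x = r) := by
    intro p hp
    by_contra hno
    obtain ⟨h₁, h₂, h₃, h₄, h₅⟩ := hPprop p hp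
    refine hcon ⟨fun b => if b then p.1 else p.2, ?_, by simpa using h₃, ?_, ?_⟩
    · rintro (_ | _) <;> simpa
    · rintro (_ | _) <;> simpa
    · intro S hS
      by_contra hr
      refine hno ⟨S, hS, fun r hK hpair => hr ⟨r, hK, ?_⟩⟩
      rintro (_ | _)
      · simpa using hpair.2
      · simpa using hpair.1
  choose! S hS hSbad using hbad
  set U : Set (Set X) := ⋃ p ∈ P, S p
  have hUfam : IsInjFamily f U := by
    refine ⟨hP.biUnion fun p hp => (hS p hp).countable, ?_, ?_⟩ <;> intro s hs <;>
      obtain ⟨p, hp, hs⟩ := mem_iUnion₂.1 hs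
    · exact (hS p hp).measurableSet s hs
    · exact (hS p hp).injOn s hs
  have hUmeas : MeasurableSet (⋃₀ U) := MeasurableSet.sUnion hUfam.countable hUfam.measurableSet
  have hsub : ∀ p ∈ P, ⋃₀ S p ⊆ ⋃₀ U := fun p hp => sUnion_subset_sUnion (subset_biUnion_of_mem hp)
  set T : Set ℝ := ⋂ k : K, f '' (W k \ ⋃₀ U)
  have hTana : AnalyticSet T := by
    have : Nonempty K := ⟨⟨i, hi⟩⟩
    have : Countable K := hK.to_subtype
    exact AnalyticSet.iInter fun k => ((hW k).measurableSet.diff hUmeas).analyticSet_image hf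
  have hinj : InjOn f ((W i \ ⋃₀ U) ∩ f ⁻¹' T) := by
    rintro x ⟨hx, hxT⟩ y ⟨hy, -⟩ hxy
    by_contra hne
    obtain ⟨p, hp, hxp, hyp⟩ := hsep x y hne
    refine hSbad p hp (f x) (fun k hk => ?_)
      ⟨⟨x, ⟨⟨hx.1, hxp⟩, fun h => hx.2 (hsub p hp h)⟩, rfl⟩,
        ⟨y, ⟨⟨hy.1, hyp⟩, fun h => hy.2 (hsub p hp h)⟩, hxy.symm⟩⟩
    obtain ⟨z, hz, hzx⟩ := mem_iInter.1 hxT ⟨k, hk⟩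
    exact ⟨z, ⟨hz.1, fun h => hz.2 (hsub p hp h)⟩, hzx⟩
  obtain ⟨B, hB, hBinj, hBsub⟩ := exists_measurableSet_superset_injOn hf
    ((hW i).measurableSet.diff hUmeas) hTana hinj
  obtain ⟨r, hr⟩ := hlarge (insert B U) ⟨hUfam.countable.insert B,
    forall_mem_insert.2 ⟨hB, hUfam.measurableSet⟩, forall_mem_insert.2 ⟨hBinj, hUfam.injOn⟩⟩
  simp only [sUnion_insert] at hr
  obtain ⟨x, ⟨hxW, hxB⟩, rfl⟩ := hr i hi
  refine hxB (.inl (hBsub ⟨⟨hxW, fun h => hxB (.inr h)⟩, mem_iInter.2 fun k => ?_⟩))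
  obtain ⟨z, hz, hzx⟩ := hr k k.2
  exact ⟨z, ⟨hz.1, fun h => hz.2 (.inr h)⟩, hzx⟩

theorem FibreLarge.exists_double {X J : Type*} [MetricSpace X] [PolishSpace X]
    [MeasurableSpace X] [BorelSpace X] {f : X → ℝ} (hf : Measurable f) {K : Set J}
    (hK : K.Finite) {U : J → Set X} (hU : ∀ j, IsClosed (U j)) (hlarge : FibreLarge f K U)
    {ε : ℝ} (hε : 0 < ε) :
    ∃ V : Bool × J → Set X, (∀ i, IsClosed (V i)) ∧ (∀ i, V i ⊆ U i.2) ∧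
      (∀ j ∈ K, Disjoint (V (true, j)) (V (false, j))) ∧
      (∀ i, i.2 ∈ K → ∀ x ∈ V i, ∀ y ∈ V i, dist x y ≤ ε) ∧
      FibreLarge f (Prod.snd ⁻¹' K) V := by
  classical
  suffices h : ∀ s : Set J, s.Finite → s ⊆ K → ∃ V : Bool × J → Set X, (∀ i, IsClosed (V i)) ∧
      (∀ i, V i ⊆ U i.2) ∧ (∀ j ∈ s, Disjoint (V (true, j)) (V (false, j))) ∧
      (∀ i, i.2 ∈ s → ∀ x ∈ V i, ∀ y ∈ V i, dist x y ≤ ε) ∧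
      (∀ i, i.2 ∉ s → V i = U i.2) ∧ FibreLarge f (Prod.snd ⁻¹' K) V by
    obtain ⟨V, h₁, h₂, h₃, h₄, -, h₅⟩ := h K hK subset_rfl
    exact ⟨V, h₁, h₂, h₃, h₄, h₅⟩
  intro s hs
  induction s, hs using Set.Finite.induction_on with
  | empty =>
    refine fun _ => ⟨fun i => U i.2, fun i => hU _, fun i => subset_rfl, by simp, by simp,
      fun _ _ => rfl, fun S hS => ?_⟩
    obtain ⟨r, hr⟩ := hlarge S hS
    exact ⟨r, fun i hi => hr i.2 hi⟩
  | @insert j s hj hs ih =>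
    intro hsub
    obtain ⟨V, hcl, hVU, hdisj, hdist, heq, hV⟩ := ih ((subset_insert _ _).trans hsub)
    have hKcount : (Prod.snd ⁻¹' K : Set (Bool × J)).Countable := by
      rw [← univ_prod]
      exact countable_univ.prod hK.countable
    obtain ⟨C, hC, hCdisj, hCdist, hCV⟩ := hV.exists_split hf hKcount hcl (i := (true, j))
      (hsub (mem_insert _ _)) hε
    have hUj : V (true, j) = U j := heq (true, j) hj
    rw [hUj] at hCV
    refine ⟨fun i => if i.2 = j then U j ∩ C i.1 else V i, ?_, ?_, ?_, ?_, ?_, ?_⟩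
    · intro i
      dsimp only
      split_ifs
      exacts [(hU j).inter (hC _), hcl i]
    · intro i
      dsimp only
      split_ifs with h
      exacts [h ▸ inter_subset_left, hVU i]
    · rintro k (rfl | hk)
      · simpa using hCdisj.mono inter_subset_right inter_subset_right
      · have hne : k ≠ j := fun h => hj (h ▸ hk)
        simpa [hne] using hdisj k hk
    · rintro ⟨b, k⟩ (rfl | hk)
      · simpa using fun x _ hx y _ hy => hCdist b x hx y hy
      · have hne : k ≠ j := fun h => hj (h ▸ hk)
        simpa [hne] using hdist (b, k) hk
    · rintro ⟨b, k⟩ hk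
      have hne : k ≠ j := fun h => hk (.inl h)
      simpa [hne] using heq (b, k) fun h => hk (.inr h)
    · intro S hS
      obtain ⟨r, hr, hrC⟩ := hCV S hS
      refine ⟨r, ?_⟩
      rintro ⟨b, k⟩ hk
      by_cases h : k = j
      · simpa [h] using hrC b
      · simpa [h] using hr (b, k) hk

/-- If no countable family of measurable sets on which `f` is injective covers `X`, there is a
Cantor scheme of closed sets whose levels meet common fibres of `f`. -/
theorem exists_cantorScheme_of_fibreLarge {X : Type*} [MetricSpace X] [PolishSpace X]
    [MeasurableSpace X] [BorelSpace X] {f : X → ℝ} (hf : Measurable f)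
    (hlarge : FibreLarge f (univ : Set Unit) fun _ => univ) :
    ∃ A : List Bool → Set X, (∀ l, IsClosed (A l)) ∧ CantorScheme.Antitone A ∧
      CantorScheme.Disjoint A ∧
      (∀ b l, ∀ x ∈ A (b :: l), ∀ y ∈ A (b :: l), dist x y ≤ 1 / ((l.length : ℝ) + 1)) ∧
      ∀ n, ∃ r, ∀ l, l.length = n → ∃ x ∈ A l, f x = r := by
  let Level (n : ℕ) := {U : List Bool → Set X //
    (∀ l, IsClosed (U l)) ∧ FibreLarge f {l | l.length = n} U}
  have hstep : ∀ n (U : Level n), ∃ U' : Level (n + 1),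
      (∀ b l, U'.1 (b :: l) ⊆ U.1 l) ∧
      (∀ l, l.length = n → Disjoint (U'.1 (true :: l)) (U'.1 (false :: l))) ∧
      ∀ b l, l.length = n → ∀ x ∈ U'.1 (b :: l), ∀ y ∈ U'.1 (b :: l),
        dist x y ≤ 1 / ((n : ℝ) + 1) := by
    rintro n ⟨U, hU, hUl⟩
    obtain ⟨V, hV, hVU, hdisj, hdist, hVl⟩ := hUl.exists_double hf (List.finite_length_eq Bool n)
      hU (Nat.one_div_pos_of_nat (n := n))
    refine ⟨⟨fun l => match l with | [] => ∅ | b :: l => V (b, l), ?_, ?_⟩, ?_, ?_, ?_⟩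
    · rintro (_ | ⟨b, l⟩)
      exacts [isClosed_empty, hV _]
    · intro S hS
      obtain ⟨r, hr⟩ := hVl S hS
      refine ⟨r, ?_⟩
      rintro (_ | ⟨b, l⟩) hl
      · simp at hl
      · exact hr (b, l) (by simpa using hl)
    · exact fun b l => hVU (b, l)
    · exact hdisj
    · exact fun b l hl => hdist (b, l) hl
  choose next hanti hdisj hdist using hstep
  let base : Level 0 := ⟨fun _ => univ, fun _ => isClosed_univ, fun S hS =>
    (hlarge S hS).imp fun r hr _ _ => hr () trivial⟩
  let lev : ∀ n, Level n := fun n => Nat.rec base next n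
  refine ⟨fun l => (lev l.length).1 l, fun l => (lev _).2.1 l, fun l b => hanti _ _ b l, ?_,
    fun b l => hdist _ _ b l rfl, fun n => ?_⟩
  · rintro l (_ | _) (_ | _) h
    · exact absurd rfl h
    · exact (hdisj _ (lev l.length) l rfl).symm
    · exact hdisj _ (lev l.length) l rfl
    · exact absurd rfl h
  · obtain ⟨r, hr⟩ := (lev n).2.2 ∅ ⟨countable_empty, by simp, by simp⟩
    refine ⟨r, ?_⟩
    rintro l rfl
    obtain ⟨x, hx, hxr⟩ := hr l rfl
    exact ⟨x, hx.1, hxr⟩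

theorem exists_uncountable_fibre_of_fibreLarge {X : Type*} [MetricSpace X] [CompleteSpace X]
    [PolishSpace X] [MeasurableSpace X] [BorelSpace X] {f : X → ℝ} (hf : Continuous f)
    (hlarge : FibreLarge f (univ : Set Unit) fun _ => univ) :
    ∃ r, ¬ (f ⁻¹' {r}).Countable := by
  obtain ⟨A, hcl, hanti, hdisj, hdist, hfib⟩ :=
    exists_cantorScheme_of_fibreLarge hf.measurable hlarge
  have hdiam : CantorScheme.VanishingDiam A := by
    intro z
    rw [← tendsto_add_atTop_iff_nat 1]
    have hlim : Tendsto (fun n : ℕ => ENNReal.ofReal (1 / ((n : ℝ) + 1))) atTop (nhds 0) := by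
      simpa using ENNReal.tendsto_ofReal tendsto_one_div_add_atTop_nhds_zero_nat
    refine tendsto_of_tendsto_of_tendsto_of_le_of_le tendsto_const_nhds hlim
      (fun _ => zero_le) fun n => Metric.ediam_le_of_forall_dist_le ?_
    simpa [PiNat.res_succ, PiNat.res_length] using hdist (z n) (PiNat.res z n)
  have hne : ∀ l, (A l).Nonempty := fun l =>
    let ⟨_, hr⟩ := hfib l.length
    let ⟨x, hx, _⟩ := hr l rfl
    ⟨x, hx⟩
  have huniv := CantorScheme.ClosureAntitone.map_of_vanishingDiam hdiam
    (hanti.closureAntitone hcl) hne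
  let g : (ℕ → Bool) → X := fun z => (CantorScheme.inducedMap A).2 ⟨z, huniv ▸ mem_univ z⟩
  have hgmem : ∀ z n, g z ∈ A (PiNat.res z n) := fun z n => CantorScheme.map_mem _ n
  have hginj : Function.Injective g := fun z w h =>
    congrArg Subtype.val (hdisj.map_injective h)
  choose r hr using hfib
  have hlim : ∀ z, Tendsto r atTop (nhds (f (g z))) := by
    intro z
    choose x hx hxr using fun n => hr n (PiNat.res z n) (PiNat.res_length z n)
    have hxg : Tendsto x atTop (nhds (g z)) := by
      rw [tendsto_iff_edist_tendsto_0]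
      exact tendsto_of_tendsto_of_tendsto_of_le_of_le tendsto_const_nhds (hdiam z)
        (fun _ => zero_le) fun n => Metric.edist_le_ediam_of_mem (hx n) (hgmem z n)
    simpa [Function.comp_def, hxr] using (hf.tendsto (g z)).comp hxg
  refine ⟨f (g fun _ => true), fun hcount => ?_⟩
  have : (range g).Countable := hcount.mono (by
    rintro _ ⟨z, rfl⟩
    exact tendsto_nhds_unique (hlim z) (hlim _))
  have hc : Countable (ℕ → Bool) := by
    rw [← image_univ] at this
    exact countable_univ_iff.1 (countable_of_injective_of_countable_image hginj.injOn this)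
  obtain ⟨e, he⟩ := exists_surjective_nat (ℕ → Bool)
  obtain ⟨n, hn⟩ := he fun n => !e n n
  simpa using congrFun hn n

/-- A Borel function with countable fibres is injective on each member of some countable Borel
cover. -/
theorem exists_measurable_cover_injOn {X : Type*} [MeasurableSpace X] [StandardBorelSpace X]
    {f : X → ℝ} (hf : Measurable f) (hcount : ∀ r, (f ⁻¹' {r}).Countable) :
    ∃ c : ℕ → Set X, (∀ n, MeasurableSet (c n) ∧ InjOn f (c n)) ∧ ⋃ n, c n = univ := by
  have hcover : ∃ S, IsInjFamily f S ∧ ⋃₀ S = univ := by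
    by_contra hno
    have hlarge : FibreLarge f (univ : Set Unit) fun _ => univ := by
      intro S hS
      obtain ⟨x, hx⟩ := (ne_univ_iff_exists_notMem _).1 fun h => hno ⟨S, hS, h⟩
      exact ⟨f x, fun _ _ => ⟨x, ⟨trivial, hx⟩, rfl⟩⟩
    obtain ⟨t, hborel, hpolish⟩ := ‹StandardBorelSpace X›.polish
    obtain ⟨t', hle, hcont, hpolish'⟩ := hf.exists_continuous
    have hborel' : @BorelSpace X t' _ :=
      @BorelSpace.mk X t' _ (by rw [hborel.measurable_eq, borel_eq_borel_of_le hpolish' hpolish hle])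
    clear hborel hpolish hle
    let := TopologicalSpace.upgradeIsCompletelyMetrizable X
    obtain ⟨r, hr⟩ := exists_uncountable_fibre_of_fibreLarge hcont hlarge
    exact hr (hcount r)
  obtain ⟨S, hS, hSuniv⟩ := hcover
  obtain ⟨c, hc⟩ := (hS.countable.insert ∅).exists_eq_range (insert_nonempty _ _)
  have hmem : ∀ n, c n ∈ insert ∅ S := fun n => hc ▸ mem_range_self n
  refine ⟨c, fun n => ?_, ?_⟩
  · rcases hmem n with h | h
    · rw [h]
      exact ⟨MeasurableSet.empty, injOn_empty f⟩
    · exact ⟨hS.measurableSet _ h, hS.injOn _ h⟩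
  · rw [← sUnion_range, ← hc, sUnion_insert, hSuniv, union_univ]

/-- The fibres of a Borel function with countable fibres admit a Borel selector. -/
theorem exists_measurable_fibre_selector {X : Type*} [MeasurableSpace X] [StandardBorelSpace X]
    {f : X → ℝ} (hf : Measurable f) (hcount : ∀ r, (f ⁻¹' {r}).Countable) :
    ∃ g : X → X, Measurable g ∧ (∀ x, f (g x) = f x) ∧ ∀ x y, f x = f y → g x = g y := by
  classical
  obtain ⟨c, hc, hcuniv⟩ := exists_measurable_cover_injOn hf hcount
  have hex : ∀ x, ∃ n, f x ∈ f '' c n := fun x => by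
    obtain ⟨n, hn⟩ := mem_iUnion.1 (hcuniv ▸ mem_univ x : x ∈ ⋃ n, c n)
    exact ⟨n, x, hn, rfl⟩
  let ν : X → ℕ := fun x => Nat.find (hex x)
  have himage : ∀ n A, MeasurableSet A → MeasurableSet (f ⁻¹' (f '' (c n ∩ A))) := fun n A hA =>
    hf (((hc n).1.inter hA).image_of_measurable_injOn hf ((hc n).2.mono inter_subset_left))
  have hν : Measurable ν := measurable_find hex fun n => by
    have h := himage n univ MeasurableSet.univ
    rw [inter_univ] at h
    exact h
  choose g hgc hgf using fun x => Nat.find_spec (hex x)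
  refine ⟨g, fun A hA => ?_, hgf, fun x y hxy => ?_⟩
  · have : g ⁻¹' A = ⋃ n, ν ⁻¹' {n} ∩ f ⁻¹' (f '' (c n ∩ A)) := by
      ext x
      simp only [mem_iUnion]
      refine ⟨fun hx => ⟨ν x, rfl, g x, ⟨hgc x, hx⟩, hgf x⟩, ?_⟩
      rintro ⟨_, rfl, y, ⟨hy, hyA⟩, hyx⟩
      have : g x = y := (hc _).2 (hgc x) hy ((hgf x).trans hyx.symm)
      rwa [mem_preimage, this]
    rw [this]
    exact MeasurableSet.iUnion fun n => (hν (measurableSet_singleton n)).inter (himage n A hA)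
  · have hνxy : ν x = ν y := by simp only [ν, hxy]
    refine (hc (ν y)).2 (hνxy ▸ hgc x) (hgc y) ?_
    rw [hgf, hgf, hxy]

/-- If `E` is a smooth countable Borel equivalence relation on a standard Borel
space `X`, then `E` has property `𝗌`; in fact, for every Borel homomorphism
`φ : X → ([ℕ]^ℕ)^ℕ` from `E` to `E_set` there is an `E`-invariant Borel
`ψ : X → [ℕ]^ℕ` such that for all `x` and `n`, either `ψ(x) ⊆* φ(x)(n)` or
`ψ(x) ⊆* ℕ \ φ(x)(n)`. -/
theorem propertyS_invariant_of_smooth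
    {X : Type*} [MeasurableSpace X] [StandardBorelSpace X]
    (E : X → X → Prop) (hEq : Equivalence E)
    (hBorel : MeasurableSet {p : X × X | E p.1 p.2})
    (hCtble : ∀ x, {y | E x y}.Countable)
    (f : X → ℝ) (hf : Measurable f) (hsmooth : ∀ x y, E x y ↔ f x = f y) :
    ∀ φ : X → ℕ → ℕ → Bool, Measurable φ → (∀ x n, IsInfSet (φ x n)) →
      (∀ x y, E x y → Set.range (φ x) = Set.range (φ y)) →
      ∃ ψ : X → ℕ → Bool, Measurable ψ ∧ (∀ x y, E x y → ψ x = ψ y) ∧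
        (∀ x, IsInfSet (ψ x)) ∧
        ∀ x n, AlmostSubset (ψ x) (φ x n) ∨ AlmostSubset (ψ x) (complB (φ x n)) := by
  intro φ hφ _ hrange
  have hcount : ∀ r, (f ⁻¹' {r}).Countable := by
    intro r
    rcases (f ⁻¹' {r}).eq_empty_or_nonempty with h | ⟨x, rfl⟩
    · rw [h]
      exact countable_empty
    · exact (hCtble x).mono fun y hy => (hsmooth x y).2 hy.symm
  obtain ⟨g, hg, hfg, hginv⟩ := exists_measurable_fibre_selector hf hcount
  refine ⟨fun x => unsplitSet (φ (g x)), measurable_unsplitSet.comp (hφ.comp hg), ?_,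
    fun x => isInfSet_unsplitSet _, fun x n => ?_⟩
  · intro x y hxy
    simp only [hginv x y ((hsmooth x y).1 hxy)]
  · have hmem : φ x n ∈ range (φ (g x)) :=
      hrange x (g x) ((hsmooth _ _).2 (hfg x).symm) ▸ mem_range_self n
    obtain ⟨m, hm⟩ := hmem
    exact hm ▸ unsplitSet_almostSubset (φ (g x)) m
end
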